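/- arXiv:2003.08118 — 2 statements merged into one kernel-verified Lean document; each statement's English description precedes it below -/
import Mathlib

section
/- Let p be an odd prime, G = C × H where C = ⟨c⟩ ≅ C₄, c₁ = c², C₁ = ⟨c₁⟩, and H ≅ C_p × C_p. Let K ∈ Sup₂^min(G_r) and 𝒜 = V(K,G). Suppose that C is not an 𝒜-subgroup, X is the basic set of 𝒜 containing c, U = ⟨X⟩, |U| = 4p, and C₁ ≤ rad(Y) for every basic set Y of 𝒜 outside U. Then 𝒜 is a nontrivial S' = U'/L'-wreath product for some 𝒜-section S' = U'/L', satisfying one of the conditions (CA), (CA'), (CA''). -/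
open scoped Pointwise

noncomputable section

namespace Paper

/-- The element `∑_{x ∈ X} x` of the integer group ring `ℤG`. -/
def sumElems {G : Type*} [Group G] [Finite G] (X : Set G) : MonoidAlgebra ℤ G :=
  ∑ x ∈ X.toFinite.toFinset, MonoidAlgebra.single x (1 : ℤ)

/-- A Schur ring (S-ring) over a finite group `G`, described by the partition of `G`
into its basic sets: the partition contains `{1}`, is closed under taking inverses,
and its `ℤ`-span inside the group ring `ℤG` is closed under multiplication
(hence is a subring of `ℤG`). -/
structure SRing (G : Type*) [Group G] [Finite G] where
  basic : Set (Set G)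
  nonempty : ∀ X ∈ basic, X.Nonempty
  cover : ∀ g : G, ∃! X, X ∈ basic ∧ g ∈ X
  one_mem : ({1} : Set G) ∈ basic
  inv_mem : ∀ X ∈ basic, X⁻¹ ∈ basic
  mul_mem : ∀ a b : MonoidAlgebra ℤ G,
    a ∈ Submodule.span ℤ (sumElems '' basic) →
    b ∈ Submodule.span ℤ (sumElems '' basic) →
    a * b ∈ Submodule.span ℤ (sumElems '' basic)

namespace SRing

/-- The `ℤ`-module underlying an S-ring. -/
def span {G : Type*} [Group G] [Finite G] (A : SRing G) :
    Submodule ℤ (MonoidAlgebra ℤ G) :=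
  Submodule.span ℤ (sumElems '' A.basic)

/-- A set `X ⊆ G` is an `𝒜`-set if `∑_{x ∈ X} x ∈ 𝒜`. -/
def IsASet {G : Type*} [Group G] [Finite G] (A : SRing G) (X : Set G) : Prop :=
  sumElems X ∈ A.span

/-- A subgroup which is an `𝒜`-set is an `𝒜`-subgroup. -/
def IsASubgroup {G : Type*} [Group G] [Finite G] (A : SRing G) (H : Subgroup G) : Prop :=
  A.IsASet (H : Set G)

end SRing

/-- The arc set `R(X) = {(g, xg) : x ∈ X, g ∈ G}` of the Cayley digraph `Cay(G, X)`. -/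
def Rel {G : Type*} [Group G] (X : Set G) : Set (G × G) := {p | p.2 * p.1⁻¹ ∈ X}

/-- `f : G ≃ G'` is an isomorphism from the S-ring `A` over `G` to the S-ring `B`
over `G'` if `{R(X)^f : X ∈ 𝒮(A)} = {R(Y) : Y ∈ 𝒮(B)}`. -/
def IsSRingIso {G G' : Type*} [Group G] [Finite G] [Group G'] [Finite G']
    (A : SRing G) (B : SRing G') (f : G ≃ G') : Prop :=
  (fun X => Prod.map f f '' Rel X) '' A.basic = Rel '' B.basic

/-- The automorphism group `Aut(𝒜)` of an S-ring, as a set of permutations of `G`. -/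
def SRing.autSet {G : Type*} [Group G] [Finite G] (A : SRing G) : Set (Equiv.Perm G) :=
  {f | ∀ X ∈ A.basic, Prod.map f f '' Rel X = Rel X}

/-- The set `Iso(𝒜)` of isomorphisms from `𝒜` onto S-rings over the same group `G`. -/
def SRing.isoSet {G : Type*} [Group G] [Finite G] (A : SRing G) : Set (Equiv.Perm G) :=
  {f | ∃ B : SRing G, IsSRingIso A B f}

/-- `Aut(G)` as a set of permutations of `G`. -/
def autPerm (G : Type*) [Group G] : Set (Equiv.Perm G) :=
  Set.range fun φ : G ≃* G => (φ.toEquiv : Equiv.Perm G)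

/-- A CI-S-ring: `Aut(𝒜)·Aut(G) = Iso(𝒜)`. -/
def SRing.IsCI {G : Type*} [Group G] [Finite G] (A : SRing G) : Prop :=
  A.autSet * autPerm G = A.isoSet

/-- The orbits on `G` of a set of automorphisms of `G`. -/
def setOrbits {G : Type*} [Group G] (Δ : Set (MulAut G)) : Set (Set G) :=
  Set.range fun g : G => (fun φ : MulAut G => φ g) '' Δ

/-- An S-ring is cyclotomic if its basic sets are exactly the orbits of some
subgroup `K ≤ Aut(G)`. -/
def SRing.IsCyclotomic {G : Type*} [Group G] [Finite G] (A : SRing G) : Prop :=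
  ∃ K : Subgroup (MulAut G), A.basic = setOrbits (K : Set (MulAut G))

/-- `Aut_G(𝒜) = Aut(𝒜) ∩ Aut(G)`, as a set of automorphisms of `G`. -/
def SRing.autGSet {G : Type*} [Group G] [Finite G] (A : SRing G) : Set (MulAut G) :=
  {φ | (φ.toEquiv : Equiv.Perm G) ∈ A.autSet}

/-- A (cyclotomic) S-ring is Cayley minimal if `Aut_G(𝒜)` is the only subgroup of
`Aut(G)` whose orbits on `G` coincide with those of `Aut_G(𝒜)`. -/
def SRing.IsCayleyMinimal {G : Type*} [Group G] [Finite G] (A : SRing G) : Prop :=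
  ∀ K : Subgroup (MulAut G),
    setOrbits (K : Set (MulAut G)) = setOrbits A.autGSet →
    (K : Set (MulAut G)) = A.autGSet

/-- `rad(X) = {g ∈ G : gX = Xg = X}`. -/
def rad {G : Type*} [Group G] (X : Set G) : Set G := {g | {g} * X = X ∧ X * {g} = X}

/-- The class `𝓔_c` of finite abelian groups all of whose Sylow subgroups are
elementary abelian or isomorphic to `C₄`. -/
def InEc (G : Type*) [CommGroup G] [Finite G] : Prop :=
  ∀ p : ℕ, p.Prime → ∀ P : Sylow p G,
    (∀ x : ↥(P : Subgroup G), x ^ p = 1) ∨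
    Nonempty (↥(P : Subgroup G) ≃* Multiplicative (ZMod 4))

/-- A finite group `G` is a `DCI`-group if any two Cayley digraphs over `G` that are
isomorphic as digraphs are Cayley isomorphic. -/
def IsDCIGroup (G : Type*) [Group G] : Prop :=
  ∀ S T : Set G,
    (∃ f : G ≃ G, ∀ g h : G, h * g⁻¹ ∈ S ↔ f h * (f g)⁻¹ ∈ T) →
    ∃ φ : G ≃* G, ⇑φ '' S = T

/-- The subgroup `G_r ≤ Sym(G)` of right translations of `G`. -/
def rightTranslations (G : Type*) [Group G] : Subgroup (Equiv.Perm G) where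
  carrier := Set.range fun g : G => Equiv.mulRight g
  one_mem' := ⟨1, by ext x; simp⟩
  mul_mem' := by
    rintro _ _ ⟨a, rfl⟩ ⟨b, rfl⟩
    exact ⟨b * a, by ext x; simp [mul_assoc]⟩
  inv_mem' := by
    rintro _ ⟨a, rfl⟩
    exact ⟨a⁻¹, by ext x; simp⟩

/-- The basic sets of the S-ring `V(K, G)`: the orbits of the stabilizer `K_e`
of the identity on `G`. -/
def VBasic {G : Type*} [Group G] (K : Subgroup (Equiv.Perm G)) : Set (Set G) :=
  Set.range fun g : G => MulAction.orbit (MulAction.stabilizer K (1 : G)) g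

/-- A subgroup `R ≤ Sym(G)` is regular if for all `g, h ∈ G` there is a
unique `r ∈ R` with `r(g) = h`. -/
def IsRegularSubgroup {G : Type*} [Group G] (R : Subgroup (Equiv.Perm G)) : Prop :=
  ∀ g h : G, ∃! r : R, (r : Equiv.Perm G) g = h

/-- `K ∈ Sup(G_r)`. -/
def InSup {G : Type*} [Group G] (K : Subgroup (Equiv.Perm G)) : Prop :=
  rightTranslations G ≤ K

/-- `K ∈ Sup₂(G_r)`, i.e. `K ≥ G_r` and `K = K^{(2)} = Aut(V(K,G))`. -/
def InSup2 {G : Type*} [Group G] [Finite G] (K : Subgroup (Equiv.Perm G)) : Prop :=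
  InSup K ∧
    (K : Set (Equiv.Perm G)) =
      {f : Equiv.Perm G | ∀ X ∈ VBasic K, Prod.map (⇑f) (⇑f) '' Rel X = Rel X}

/-- `K₁ ⪯_G K₂`: `K₁ ≤ K₂` and every regular subgroup of `K₂` isomorphic to `G`
is conjugate in `K₂` to a subgroup of `K₁`. -/
def GComplete {G : Type*} [Group G] (K₁ K₂ : Subgroup (Equiv.Perm G)) : Prop :=
  K₁ ≤ K₂ ∧ ∀ R : Subgroup (Equiv.Perm G), R ≤ K₂ → IsRegularSubgroup R →
    Nonempty (↥R ≃* G) → ∃ k ∈ K₂, ∀ r ∈ R, k * r * k⁻¹ ∈ K₁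

/-- `K ∈ Sup₂^min(G_r)`: a minimal element of `Sup₂(G_r)` with respect to `⪯_G`. -/
def InSup2Min {G : Type*} [Group G] [Finite G] (K : Subgroup (Equiv.Perm G)) : Prop :=
  InSup2 K ∧ ∀ K' : Subgroup (Equiv.Perm G), InSup2 K' → GComplete K' K → K' = K

/-- The basic sets of the restriction `𝒜_U` of `𝒜` to an `𝒜`-subgroup `U`:
the basic sets of `𝒜` contained in `U`, viewed inside `U`. -/
def restrictBasic {G : Type*} [Group G] [Finite G] (A : SRing G) (U : Subgroup G) :
    Set (Set ↥U) :=
  {Y : Set ↥U | Subtype.val '' Y ∈ A.basic}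

/-- The basic sets of the quotient S-ring `𝒜_{G/L}`: the images of the basic
sets of `𝒜` under the canonical epimorphism `G → G/L`. -/
def quotBasic {G : Type*} [CommGroup G] [Finite G] (A : SRing G) (L : Subgroup G) :
    Set (Set (G ⧸ L)) :=
  (fun X => QuotientGroup.mk '' X) '' A.basic

/-- The basic sets of the S-ring `𝒜_S` on the section `S = U/L`: the images under
the canonical epimorphism `U → U/L` of the basic sets of `𝒜` contained in `U`. -/
def secBasic {G : Type*} [CommGroup G] [Finite G] (A : SRing G) (U L : Subgroup G) :
    Set (Set (↥U ⧸ L.subgroupOf U)) :=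
  {Z | ∃ X ∈ A.basic, X ⊆ (U : Set G) ∧
    Z = QuotientGroup.mk '' (Subtype.val ⁻¹' X : Set ↥U)}

/-- The set of bijections of `H ⧸ N` induced by members of `Δ ⊆ Sym(H)`
permuting the `N`-cosets. -/
def inducedOnQuot {H : Type*} [CommGroup H] (N : Subgroup H) (Δ : Set (Equiv.Perm H)) :
    Set (Equiv.Perm (H ⧸ N)) :=
  {σ | ∃ f ∈ Δ, ∀ x : H, σ (QuotientGroup.mk x) = QuotientGroup.mk (f x)}

/-- The canonical (injective) homomorphism `U/L → G/L` for `L ≤ U ≤ G`. -/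
def secIncl {G : Type*} [CommGroup G] (U L : Subgroup G) :
    (↥U ⧸ L.subgroupOf U) →* G ⧸ L :=
  QuotientGroup.map (L.subgroupOf U) L U.subtype (fun _ hx => hx)

/-- The set of bijections of the section `S = U/L` induced by members of
`Δ ⊆ Sym(G/L)` preserving `S` (i.e. permuting the `L`-cosets contained in `U`). -/
def inducedOnSec {G : Type*} [CommGroup G] (U L : Subgroup G)
    (Δ : Set (Equiv.Perm (G ⧸ L))) : Set (Equiv.Perm (↥U ⧸ L.subgroupOf U)) :=
  {σ | ∃ φ ∈ Δ, ∀ x : ↥U,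
    φ (QuotientGroup.mk (x : G) : G ⧸ L) = secIncl U L (σ (QuotientGroup.mk x))}

/-- The basic sets of the S-ring `(ℤL ⊗ 𝒜_V) ≀_{(V×L)/V} ℤ(U/V)` over `U`,
where `Lu, V ≤ U` and `𝒜_V` is the restriction of `𝒜_U` to `V`. -/
def tensorWreathBasic {U : Type*} [CommGroup U] [Finite U] (AU : SRing U)
    (Lu V : Subgroup U) : Set (Set U) :=
  {Z | (∃ l ∈ Lu, ∃ X ∈ AU.basic, X ⊆ (V : Set U) ∧ Z = l • X) ∨
       (∃ u : U, u ∉ Lu ⊔ V ∧ Z = u • (V : Set U))}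

/-- Condition (CA): `𝒜_S = ℤS`. -/
def CondCA {G : Type*} [CommGroup G] [Finite G] (A : SRing G) (U L : Subgroup G) : Prop :=
  ∀ AS : SRing (↥U ⧸ L.subgroupOf U), AS.basic = secBasic A U L →
    AS.basic = Set.range fun s => ({s} : Set (↥U ⧸ L.subgroupOf U))

/-- Condition (CA'): `𝒜_U` or `𝒜_{G/L}` is cyclotomic and `𝒜_S` is Cayley minimal. -/
def CondCA' {G : Type*} [CommGroup G] [Finite G] (A : SRing G) (U L : Subgroup G) : Prop :=
  ((∀ AU : SRing ↥U, AU.basic = restrictBasic A U → AU.IsCyclotomic) ∨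
   (∀ AQ : SRing (G ⧸ L), AQ.basic = quotBasic A L → AQ.IsCyclotomic)) ∧
  (∀ AS : SRing (↥U ⧸ L.subgroupOf U), AS.basic = secBasic A U L → AS.IsCayleyMinimal)

/-- Condition (CA''): `U ≅ C_{4p}`, `L ≅ C₂` and
`𝒜_U = (ℤL ⊗ 𝒜_V) ≀_{(V×L)/V} ℤ(U/V)` for an `𝒜_U`-subgroup `V` of order `p`. -/
def CondCA'' {G : Type*} [CommGroup G] [Finite G] (p : ℕ) (A : SRing G)
    (U L : Subgroup G) : Prop :=
  Nat.card ↥U = 4 * p ∧ IsCyclic ↥U ∧ Nat.card ↥L = 2 ∧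
  ∀ AU : SRing ↥U, AU.basic = restrictBasic A U →
    ∃ V : Subgroup ↥U, AU.IsASubgroup V ∧ Nat.card ↥V = p ∧
      AU.basic = tensorWreathBasic AU (L.subgroupOf U) V

/-- `𝒜 = 𝒜_{G₁} ⊗ 𝒜_{G₂}` for `G = G₁ × G₂` (internally). -/
def IsTensorDecomp {G : Type*} [CommGroup G] [Finite G] (A : SRing G)
    (G₁ G₂ : Subgroup G) : Prop :=
  A.IsASubgroup G₁ ∧ A.IsASubgroup G₂ ∧ G₁ ⊓ G₂ = ⊥ ∧ G₁ ⊔ G₂ = ⊤ ∧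
  A.basic = {Z | ∃ X ∈ A.basic, ∃ Y ∈ A.basic,
    X ⊆ (G₁ : Set G) ∧ Y ⊆ (G₂ : Set G) ∧ Z = X * Y}

/-- `𝒜` is the tensor product of two S-rings over proper nontrivial subgroups of `G`. -/
def TensorConclusion {G : Type*} [CommGroup G] [Finite G] (A : SRing G) : Prop :=
  ∃ G₁ G₂ : Subgroup G, G₁ ≠ ⊥ ∧ G₁ ≠ ⊤ ∧ G₂ ≠ ⊥ ∧ G₂ ≠ ⊤ ∧ IsTensorDecomp A G₁ G₂

/-- `𝒜` is a nontrivial `S = U/L`-wreath product satisfying one of the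
conditions (CA), (CA'), (CA''). -/
def WreathConclusion {G : Type*} [CommGroup G] [Finite G] (p : ℕ) (A : SRing G) : Prop :=
  ∃ U L : Subgroup G, L ≤ U ∧ A.IsASubgroup U ∧ A.IsASubgroup L ∧ L ≠ ⊥ ∧ U ≠ ⊤ ∧
    (∀ X ∈ A.basic, ¬ X ⊆ (U : Set G) → (L : Set G) ⊆ rad X) ∧
    (CondCA A U L ∨ CondCA' A U L ∨ CondCA'' p A U L)



section SchurRings

variable {G : Type*} [CommGroup G]

theorem rad_eq_stabilizer (Y : Set G) : rad Y = (MulAction.stabilizer G Y : Set G) := by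
  ext g
  rw [rad, Set.mem_ofPred_eq, mul_comm Y, and_self, Set.singleton_mul]
  rfl

variable [Finite G]

open Classical in
theorem coeff_sumElems (X : Set G) (g : G) :
    (sumElems X).coeff g = if g ∈ X then 1 else 0 := by
  simp [sumElems, MonoidAlgebra.coeff_single, Finsupp.single_apply]

theorem SRing.mem_span_iff (A : SRing G) (a : MonoidAlgebra ℤ G) :
    a ∈ A.span ↔ ∀ X ∈ A.basic, ∀ x ∈ X, ∀ y ∈ X, a.coeff x = a.coeff y := by
  classical
  constructor
  · intro ha X hX x hx y hy
    induction ha using Submodule.span_induction with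
    | mem b hb =>
      obtain ⟨Y, hY, rfl⟩ := hb
      have key : x ∈ Y ↔ y ∈ Y := by
        constructor
        · intro h
          rwa [← (A.cover x).unique ⟨hX, hx⟩ ⟨hY, h⟩]
        · intro h
          rwa [← (A.cover y).unique ⟨hX, hy⟩ ⟨hY, h⟩]
      simp [coeff_sumElems, key]
    | zero => simp
    | add b d _ _ hb hd => simp [hb, hd]
    | smul r b _ hb =>
      rw [MonoidAlgebra.coeff_smul, Finsupp.smul_apply, Finsupp.smul_apply, hb]
  · intro h
    have hfin : A.basic.Finite := Set.toFinite _
    choose! r hr using A.nonempty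
    have : a = ∑ X ∈ hfin.toFinset, a.coeff (r X) • sumElems X := by
      ext g
      obtain ⟨Z, ⟨hZ, hgZ⟩, huniq⟩ := A.cover g
      simp only [MonoidAlgebra.coeff_sum, Finsupp.coe_finsetSum, Finset.sum_apply,
        MonoidAlgebra.coeff_smul, Finsupp.smul_apply, coeff_sumElems]
      rw [Finset.sum_eq_single Z]
      · simp [hgZ, h Z hZ g hgZ (r Z) (hr Z hZ)]
      · intro W hW hne
        have hgW : g ∉ W := fun hg => hne (huniq W ⟨by simpa using hW, hg⟩)
        simp [hgW]
      · intro hn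
        exact absurd (by simpa using hZ) hn
    rw [this]
    exact Submodule.sum_mem _ fun X hX => Submodule.smul_mem _ _
      (Submodule.subset_span ⟨X, by simpa using hX, rfl⟩)

/-- `𝒜`-sets are exactly the unions of basic sets. -/
theorem SRing.isASet_iff (A : SRing G) (Z : Set G) :
    A.IsASet Z ↔ ∀ X ∈ A.basic, ∀ x ∈ X, x ∈ Z → X ⊆ Z := by
  classical
  rw [SRing.IsASet, A.mem_span_iff]
  constructor
  · intro h X hX x hx hxZ y hy
    have := h X hX x hx y hy
    by_contra hyZ
    simp [coeff_sumElems, hxZ, hyZ] at this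
  · intro h X hX x hx y hy
    have key : x ∈ Z ↔ y ∈ Z := ⟨fun hz => h X hX x hx hz hy, fun hz => h X hX y hy hz hx⟩
    simp [coeff_sumElems, key]

theorem SRing.isASet_of_mem_basic (A : SRing G) {X : Set G} (hX : X ∈ A.basic) : A.IsASet X :=
  Submodule.subset_span ⟨X, hX, rfl⟩

theorem SRing.basic_eq (A : SRing G) {X Y : Set G} (hX : X ∈ A.basic) (hY : Y ∈ A.basic)
    {x : G} (hx : x ∈ X) (hy : x ∈ Y) : X = Y :=
  (A.cover x).unique ⟨hX, hx⟩ ⟨hY, hy⟩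

theorem SRing.isASet_preimage_val {A : SRing G} {U : Subgroup G} {B : SRing U}
    (hB : B.basic = restrictBasic A U) {Z : Set G} (hZ : A.IsASet Z) :
    B.IsASet (Subtype.val ⁻¹' Z) := by
  rw [B.isASet_iff, hB]
  intro X hX x hx hxZ y hy
  exact (A.isASet_iff _).1 hZ _ hX _ ⟨x, hx, rfl⟩ hxZ ⟨y, hy, rfl⟩

/-- A family of basic sets covering the group contains all of them. -/
theorem SRing.basic_eq_of_cover {A : SRing G} {S : Set (Set G)} (hS : S ⊆ A.basic)
    (hcov : ∀ x, ∃ Z ∈ S, x ∈ Z) : A.basic = S := by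
  refine Set.Subset.antisymm (fun X hX => ?_) hS
  obtain ⟨x, hx⟩ := A.nonempty X hX
  obtain ⟨Z, hZ, hxZ⟩ := hcov x
  rwa [A.basic_eq hX (hS hZ) hx hxZ]

theorem SRing.IsASet.union {A : SRing G} {Y Z : Set G} (hY : A.IsASet Y) (hZ : A.IsASet Z) :
    A.IsASet (Y ∪ Z) := by
  rw [A.isASet_iff] at *
  rintro X hX x hx (h | h)
  · exact (hY X hX x hx h).trans Set.subset_union_left
  · exact (hZ X hX x hx h).trans Set.subset_union_right

/-- A set described by the coefficients of an element of the S-ring is an `𝒜`-set. -/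
theorem SRing.isASet_setOf_coeff (A : SRing G) {a : MonoidAlgebra ℤ G} (ha : a ∈ A.span)
    (P : ℤ → Prop) : A.IsASet {g | P (a.coeff g)} := by
  rw [A.isASet_iff]
  intro X hX x hx hxP y hy
  simpa [← (A.mem_span_iff a).1 ha X hX x hx y hy] using hxP

theorem coeff_sumElems_mul (Y Z : Set G) (g : G) :
    (sumElems Y * sumElems Z).coeff g = ({y | y ∈ Y ∧ y⁻¹ * g ∈ Z}.ncard : ℤ) := by
  classical
  have : (sumElems Y * sumElems Z).coeff g
      = ∑ y ∈ Y.toFinite.toFinset, if y⁻¹ * g ∈ Z then (1 : ℤ) else 0 := by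
    rw [sumElems, Finset.sum_mul, MonoidAlgebra.coeff_sum, Finsupp.coe_finsetSum,
      Finset.sum_apply]
    refine Finset.sum_congr rfl fun y _ => ?_
    rw [MonoidAlgebra.coeff_single_mul_apply, coeff_sumElems, one_mul]
  rw [this, Finset.sum_boole, ← Set.ncard_coe_finset]
  congr 2
  ext y
  simp

theorem SRing.IsASet.mul {A : SRing G} {Y Z : Set G} (hY : A.IsASet Y) (hZ : A.IsASet Z) :
    A.IsASet (Y * Z) := by
  convert A.isASet_setOf_coeff (A.mul_mem _ _ hY hZ) (· ≠ 0) using 1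
  ext g
  rw [Set.mem_ofPred_eq, coeff_sumElems_mul, Ne, Nat.cast_eq_zero, Set.ncard_eq_zero,
    ← Ne, ← Set.nonempty_iff_ne_empty, Set.mem_mul]
  constructor
  · rintro ⟨y, hy, z, hz, rfl⟩
    exact ⟨y, hy, by simpa using hz⟩
  · rintro ⟨y, hy, hz⟩
    exact ⟨y, hy, _, hz, by simp⟩

theorem zpowers_subset_rad {t : G} {Y : Set G} (h : ∀ y ∈ Y, t * y ∈ Y) :
    (Subgroup.zpowers t : Set G) ⊆ rad Y := by
  rw [rad_eq_stabilizer, SetLike.coe_subset_coe, Subgroup.zpowers_le,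
    MulAction.mem_stabilizer_iff]
  refine Set.eq_of_subset_of_ncard_le ?_ (Set.ncard_smul_set t Y).ge
  rintro _ ⟨y, hy, rfl⟩
  exact h y hy

theorem SRing.isASet_rad (A : SRing G) {Y : Set G} (hY : Y ∈ A.basic) : A.IsASet (rad Y) := by
  convert A.isASet_setOf_coeff (A.mul_mem _ _ (A.isASet_of_mem_basic hY)
    (A.isASet_of_mem_basic (A.inv_mem Y hY))) (· = Y.ncard) using 1
  ext g
  rw [Set.mem_ofPred_eq, coeff_sumElems_mul, Nat.cast_inj]
  rw [rad_eq_stabilizer, SetLike.mem_coe, MulAction.mem_stabilizer_iff]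
  constructor
  · intro h
    congr 1
    ext y
    refine ⟨fun hy => hy.1, fun hy => ⟨hy, ?_⟩⟩
    rw [← h, Set.mem_smul_set_iff_inv_smul_mem] at hy
    simpa [mul_comm] using hy
  · intro h
    have h1 := Set.eq_of_subset_of_ncard_le (fun y (hy : y ∈ Y ∧ y⁻¹ * g ∈ Y⁻¹) => hy.1) h.ge
    have h2 : Y ⊆ g • Y := by
      intro y hy
      rw [← h1] at hy
      rw [Set.mem_smul_set_iff_inv_smul_mem]
      simpa [mul_comm] using hy.2
    exact (Set.eq_of_subset_of_ncard_le h2 (by rw [Set.ncard_smul_set])).symm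

theorem SRing.isASubgroup_closure {A : SRing G} {D : Set G} (hD : A.IsASet D) :
    A.IsASubgroup (Subgroup.closure D) := by
  choose b hb _ using A.cover
  let T : Subgroup G :=
    { carrier := {g | b g ⊆ Subgroup.closure D}
      one_mem' := by
        rw [Set.mem_ofPred_eq, A.basic_eq (hb 1).1 A.one_mem (hb 1).2 rfl]
        simp
      mul_mem' := by
        intro x y hx hy
        refine ((A.isASet_iff _).1 ((A.isASet_of_mem_basic (hb x).1).mul
          (A.isASet_of_mem_basic (hb y).1)) _ (hb (x * y)).1 _ (hb (x * y)).2
          (Set.mul_mem_mul (hb x).2 (hb y).2)).trans ?_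
        rintro _ ⟨u, hu, v, hv, rfl⟩
        exact Subgroup.mul_mem _ (hx hu) (hy hv)
      inv_mem' := by
        intro x hx
        rw [Set.mem_ofPred_eq, A.basic_eq (hb x⁻¹).1 (A.inv_mem _ (hb x).1) (hb x⁻¹).2
          (by simpa using (hb x).2)]
        intro y hy
        simpa using hx hy }
  have hT : Subgroup.closure D ≤ T := by
    rw [Subgroup.closure_le]
    intro x hx
    exact ((A.isASet_iff _).1 hD _ (hb x).1 _ (hb x).2 hx).trans Subgroup.subset_closure
  rw [SRing.IsASubgroup, A.isASet_iff]
  intro X hX x hx hxD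
  rw [A.basic_eq hX (hb x).1 hx (hb x).2]
  exact hT hxD

/-- Schur's theorem on powers of `𝒜`-sets. -/
theorem SRing.isASet_pow {A : SRing G} {Z : Set G} (hZ : A.IsASet Z) {q : ℕ} (hq : q.Prime) :
    A.IsASet {g | ¬ q ∣ {x | x ∈ Z ∧ x ^ q = g}.ncard} := by
  classical
  have := Fact.mk hq
  have hmem : ∀ n : ℕ, sumElems Z ^ (n + 1) ∈ A.span := by
    intro n
    induction n with
    | zero => rw [zero_add, pow_one]; exact hZ
    | succ n ih => rw [pow_succ]; exact A.mul_mem _ _ ih hZ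
  have hspan : sumElems Z ^ q ∈ A.span := by
    obtain ⟨n, rfl⟩ := Nat.exists_eq_succ_of_ne_zero hq.ne_zero
    exact hmem n
  have : CharP (MonoidAlgebra (ZMod q) G) q :=
    charP_of_injective_algebraMap (algebraMap (ZMod q) (MonoidAlgebra (ZMod q) G)).injective q
  convert A.isASet_setOf_coeff hspan (fun k => ¬ (q : ℤ) ∣ k) using 1
  ext g
  rw [Set.mem_ofPred_eq, Set.mem_ofPred_eq, ← Int.natCast_dvd_natCast, not_iff_not,
    ← ZMod.intCast_zmod_eq_zero_iff_dvd, ← ZMod.intCast_zmod_eq_zero_iff_dvd]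
  have h1 : (((sumElems Z ^ q).coeff g : ℤ) : ZMod q)
      = (MonoidAlgebra.mapRingHom G (Int.castRingHom (ZMod q)) (sumElems Z ^ q)).coeff g := by
    rw [MonoidAlgebra.coeff_mapRingHom]
    rfl
  have h2 : MonoidAlgebra.mapRingHom G (Int.castRingHom (ZMod q)) (sumElems Z)
      = ∑ x ∈ Z.toFinite.toFinset, MonoidAlgebra.single x 1 := by
    simp [sumElems]
  rw [h1, map_pow, h2, sum_pow_char]
  simp only [MonoidAlgebra.single_pow, one_pow, MonoidAlgebra.coeff_sum, Finsupp.coe_finsetSum,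
    Finset.sum_apply, MonoidAlgebra.coeff_single, Finsupp.single_apply, Finset.sum_boole]
  rw [← Set.ncard_coe_finset]
  simp

/-- Schur's theorem on multipliers. -/
theorem SRing.isASet_image_pow {A : SRing G} {Z : Set G} (hZ : A.IsASet Z) {q : ℕ}
    (hq : q.Prime) (hcop : (Nat.card G).Coprime q) : A.IsASet ((· ^ q) '' Z) := by
  convert SRing.isASet_pow hZ hq using 1
  have hinj : Function.Injective fun x : G => x ^ q := (powCoprime hcop).injective
  ext g
  by_cases h : ∃ x ∈ Z, x ^ q = g
  · obtain ⟨x, hx, rfl⟩ := h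
    have : {y | y ∈ Z ∧ y ^ q = x ^ q} = {x} := by
      ext y
      exact ⟨fun hy => hinj hy.2, by rintro rfl; exact ⟨hx, rfl⟩⟩
    simp only [Set.mem_ofPred_eq, this, Set.ncard_singleton, Nat.dvd_one, hq.ne_one]
    simpa using ⟨x, hx, rfl⟩
  · have : {y | y ∈ Z ∧ y ^ q = g} = ∅ := by
      ext y
      exact ⟨fun hy => h ⟨y, hy⟩, False.elim⟩
    simp only [Set.mem_ofPred_eq, this, Set.ncard_empty, dvd_zero, not_true_eq_false, iff_false]
    exact h

/-- The map `x ↦ x ^ q` fixes a basic set as soon as it maps one of its elements into it. -/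
theorem SRing.image_pow_eq {A : SRing G} {Z : Set G} (hZ : Z ∈ A.basic) {q : ℕ}
    (hq : q.Prime) (hcop : (Nat.card G).Coprime q) {z : G} (hz : z ∈ Z) (hzq : z ^ q ∈ Z) :
    (· ^ q) '' Z = Z := by
  have hinj : Function.Injective fun x : G => x ^ q := (powCoprime hcop).injective
  refine (Set.eq_of_subset_of_ncard_le ((A.isASet_iff _).1
    (SRing.isASet_image_pow (A.isASet_of_mem_basic hZ) hq hcop) Z hZ _ hzq ⟨z, hz, rfl⟩) ?_).symm
  rw [Set.ncard_image_of_injective _ hinj]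

/-- If the squaring map has kernel `{1, t}`, then the squares of the elements `y ∈ Y` with
`t * y ∉ Y` form an `𝒜`-set. -/
theorem SRing.isASet_sq {A : SRing G} {Y : Set G} (hY : A.IsASet Y) {t : G} (ht : t ≠ 1)
    (hker : ∀ x : G, x ^ 2 = 1 ↔ x = 1 ∨ x = t) :
    A.IsASet {g | ∃ y ∈ Y, t * y ∉ Y ∧ y ^ 2 = g} := by
  convert SRing.isASet_pow hY Nat.prime_two using 1
  have ht2 : t ^ 2 = 1 := (hker t).2 (Or.inr rfl)
  have hfib : ∀ x y : G, x ^ 2 = y ^ 2 ↔ x = y ∨ x = t * y := by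
    intro x y
    rw [← div_eq_one, ← div_pow, hker, div_eq_one, div_eq_iff_eq_mul]
  ext g
  rw [Set.mem_ofPred_eq, Set.mem_ofPred_eq]
  constructor
  · rintro ⟨y, hy, hty, rfl⟩
    have : {x | x ∈ Y ∧ x ^ 2 = y ^ 2} = {y} := by
      ext x
      simp only [hfib, Set.mem_ofPred_eq, Set.mem_singleton_iff]
      constructor
      · rintro ⟨hx, rfl | rfl⟩
        · rfl
        · exact absurd hx hty
      · rintro rfl
        exact ⟨hy, Or.inl rfl⟩
    simp [this]
  · intro hodd
    have hne : {x | x ∈ Y ∧ x ^ 2 = g}.Nonempty := by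
      rw [Set.nonempty_iff_ne_empty]
      intro h
      simp [h] at hodd
    obtain ⟨y, hy, rfl⟩ := hne
    refine ⟨y, hy, fun hty => hodd ?_, rfl⟩
    have : {x | x ∈ Y ∧ x ^ 2 = y ^ 2} = {y, t * y} := by
      ext x
      simp only [hfib, Set.mem_ofPred_eq, Set.mem_insert_iff, Set.mem_singleton_iff]
      constructor
      · exact fun h => h.2
      · rintro (rfl | rfl)
        · exact ⟨hy, Or.inl rfl⟩
        · exact ⟨hty, Or.inr rfl⟩
    rw [this, Set.ncard_pair]
    intro h
    exact ht (by simpa using h)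

/-- Translation by `s` preserves basic sets when `{s}` is a basic set. -/
theorem SRing.smul_mem_basic {A : SRing G} {s : G} (hs : {s} ∈ A.basic) {Z : Set G}
    (hZ : Z ∈ A.basic) : s • Z ∈ A.basic := by
  have hsinv : {s⁻¹} ∈ A.basic := by simpa using A.inv_mem _ hs
  have key : ∀ r : G, {r} ∈ A.basic → ∀ W ∈ A.basic, A.IsASet (r • W) := by
    intro r hr W hW
    have := (A.isASet_of_mem_basic hr).mul (A.isASet_of_mem_basic hW)
    rwa [Set.singleton_mul] at this
  obtain ⟨z, hz⟩ := A.nonempty Z hZ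
  obtain ⟨W, ⟨hW, hzW⟩, -⟩ := A.cover (s * z)
  have h1 : W ⊆ s • Z :=
    (A.isASet_iff _).1 (key s hs Z hZ) W hW _ hzW ⟨z, hz, rfl⟩
  have h2 : Z ⊆ s⁻¹ • W :=
    (A.isASet_iff _).1 (key _ hsinv W hW) Z hZ _ hz ⟨_, hzW, by simp⟩
  have h3 : s • Z = W := by
    refine (h1.antisymm ?_).symm
    rintro _ ⟨x, hx, rfl⟩
    obtain ⟨w, hw, rfl⟩ := h2 hx
    simpa using hw
  rwa [h3]

theorem SRing.basic_eq_tensorWreathBasic {A : SRing G} {L V : Subgroup G}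
    (hL : ∀ l ∈ L, {l} ∈ A.basic) (hV : A.IsASubgroup V)
    (hout : ∀ x ∉ L ⊔ V, x • (V : Set G) ∈ A.basic) : A.basic = tensorWreathBasic A L V := by
  refine A.basic_eq_of_cover ?_ fun x => ?_
  · rintro _ (⟨l, hl, X, hX, -, rfl⟩ | ⟨u, hu, rfl⟩)
    · exact SRing.smul_mem_basic (hL l hl) hX
    · exact hout u hu
  · by_cases hx : x ∈ L ⊔ V
    · obtain ⟨l, hl, v, hv, rfl⟩ := Subgroup.mem_sup.1 hx
      obtain ⟨X, ⟨hX, hvX⟩, -⟩ := A.cover v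
      exact ⟨l • X, Or.inl ⟨l, hl, X, hX, (A.isASet_iff _).1 hV X hX v hvX hv, rfl⟩,
        v, hvX, rfl⟩
    · exact ⟨_, Or.inr ⟨x, hx, rfl⟩, 1, V.one_mem, by simp⟩

end SchurRings

section SectionConditions

variable {G : Type*} [CommGroup G] [Finite G]

theorem SRing.basic_eq_singletons (A : SRing G) (hcard : Nat.card G ≤ 2) :
    A.basic = Set.range fun s => ({s} : Set G) := by
  have hsingle : ∀ X ∈ A.basic, ∀ x ∈ X, X = {x} := by
    intro X hX x hx
    by_contra hne
    obtain ⟨y, hy, hyx⟩ : ∃ y ∈ X, y ≠ x := by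
      by_contra! h
      exact hne (Set.eq_singleton_iff_unique_mem.2 ⟨hx, h⟩)
    have h1 : (1 : G) ∉ X := by
      intro h
      rw [A.basic_eq hX A.one_mem h rfl] at hx hy
      exact hyx (hy.trans hx.symm)
    have h3 : ({1, x, y} : Set G).ncard ≤ 2 := (Set.ncard_le_card _).trans hcard
    rw [Set.ncard_eq_three.2 ⟨1, x, y, fun h => h1 (h ▸ hx), fun h => h1 (h ▸ hy), hyx.symm, rfl⟩]
      at h3
    omega
  ext X
  constructor
  · intro hX
    obtain ⟨x, hx⟩ := A.nonempty X hX
    exact ⟨x, (hsingle X hX x hx).symm⟩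
  · rintro ⟨x, rfl⟩
    obtain ⟨X, ⟨hX, hx⟩, -⟩ := A.cover x
    simpa [← hsingle X hX x hx] using hX

theorem condCA_of_relIndex_le_two (A : SRing G) {U L : Subgroup G} (h : L.relIndex U ≤ 2) :
    CondCA A U L :=
  fun AS _ => AS.basic_eq_singletons h

/-- Over a cyclic group every S-ring is Cayley minimal. -/
theorem SRing.isCayleyMinimal_of_isCyclic [IsCyclic G] (A : SRing G) : A.IsCayleyMinimal := by
  intro K hK
  obtain ⟨g, hg⟩ := IsCyclic.exists_generator (α := G)
  have hgen : ∀ φ ψ : MulAut G, φ g = ψ g → φ = ψ := by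
    intro φ ψ h
    ext x
    obtain ⟨n, rfl⟩ := Subgroup.mem_zpowers_iff.1 (hg x)
    rw [map_zpow, map_zpow, h]
  have hone : (1 : MulAut G) ∈ A.autGSet := by
    intro X _
    change Prod.map id id '' Rel X = Rel X
    simp
  have horbit : (fun φ : MulAut G => φ g) '' (K : Set (MulAut G))
      = (fun φ : MulAut G => φ g) '' A.autGSet := by
    have hmem : (fun φ : MulAut G => φ g) '' A.autGSet ∈ setOrbits (K : Set (MulAut G)) := by
      rw [hK]
      exact ⟨g, rfl⟩
    obtain ⟨x, hx⟩ := hmem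
    rw [← hx]
    have hgx : g ∈ (fun φ : MulAut G => φ x) '' (K : Set (MulAut G)) := by
      rw [show (fun φ : MulAut G => φ x) '' (K : Set (MulAut G)) = _ from hx]
      exact ⟨1, hone, rfl⟩
    obtain ⟨κ, hκ, rfl⟩ := hgx
    ext y
    constructor
    · rintro ⟨φ, hφ, rfl⟩
      exact ⟨φ * κ, K.mul_mem hφ hκ, rfl⟩
    · rintro ⟨φ, hφ, rfl⟩
      exact ⟨φ * κ⁻¹, K.mul_mem hφ (K.inv_mem hκ), by simp⟩
  ext φ
  constructor
  · intro hφ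
    obtain ⟨ψ, hψ, h⟩ := horbit.subset ⟨φ, hφ, rfl⟩
    rwa [← hgen ψ φ h]
  · intro hφ
    obtain ⟨ψ, hψ, h⟩ := horbit.superset ⟨φ, hφ, rfl⟩
    rwa [← hgen ψ φ h]

end SectionConditions

section PrimePowers

theorem exists_prime_modEq_one_four {p k : ℕ} (hp : p.Prime) (hodd : Odd p) (hk : ¬ p ∣ k) :
    ∃ q, q.Prime ∧ p < q ∧ q ≡ 1 [MOD 4] ∧ q ≡ k [MOD p] := by
  have h4p : Nat.Coprime 4 p := by
    rw [show 4 = 2 ^ 2 by rfl]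
    exact Nat.Coprime.pow_left 2 (Nat.coprime_two_left.2 hodd)
  obtain ⟨m, hm4, hmp⟩ := Nat.chineseRemainder h4p 1 k
  have hm : m.Coprime (4 * p) := by
    refine Nat.Coprime.mul_right ?_ ?_
    · rw [Nat.Coprime, hm4.gcd_eq, Nat.gcd_one_left]
    · rw [Nat.Coprime, hmp.gcd_eq]
      exact ((Nat.Prime.coprime_iff_not_dvd hp).2 hk).symm
  obtain ⟨q, hpq, hq, hqm⟩ := Nat.forall_exists_prime_gt_and_modEq p
    (mul_ne_zero four_ne_zero hp.ne_zero) hm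
  exact ⟨q, hq, hpq, (hqm.of_mul_right p).trans hm4, (hqm.of_mul_left 4).trans hmp⟩

theorem coprime_of_dvd_four_mul_sq {n p q : ℕ} (hp : p.Prime) (hn : n ∣ 4 * p ^ 2)
    (hq : q.Prime) (hpq : p < q) (hq4 : q ≡ 1 [MOD 4]) : n.Coprime q := by
  refine Nat.Coprime.symm ((Nat.Prime.coprime_iff_not_dvd hq).2 fun h => ?_)
  rcases (Nat.Prime.dvd_mul hq).1 (h.trans hn) with h | h
  · have : q ∣ 2 := hq.dvd_of_dvd_pow (show q ∣ 2 ^ 2 from h)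
    rw [(Nat.prime_dvd_prime_iff_eq hq Nat.prime_two).1 this] at hq4
    exact absurd hq4 (by decide)
  · have := (Nat.prime_dvd_prime_iff_eq hq hp).1 (hq.dvd_of_dvd_pow h)
    omega

variable {G : Type*} [CommGroup G]

theorem pow_eq_self_of_modEq {n q : ℕ} {x : G} (hx : x ^ n = 1) (hq : q ≡ 1 [MOD n]) :
    x ^ q = x := by
  conv_rhs => rw [← pow_one x]
  exact pow_eq_pow_iff_modEq.2 (hq.of_dvd (orderOf_dvd_of_pow_eq_one hx))

/-- Nontrivial elements of a subgroup of odd prime order `p` are prime powers of each other. -/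
theorem exists_prime_pow_eq {p : ℕ} (hp : p.Prime) (hodd : Odd p) {V : Subgroup G}
    (hV : Nat.card V = p) {x y : G} (hx : x ∈ V) (hy : y ∈ V) (hx1 : x ≠ 1) (hy1 : y ≠ 1) :
    ∃ q, q.Prime ∧ p < q ∧ q ≡ 1 [MOD 4] ∧ x ^ q = y := by
  have := Fact.mk hp
  have hxp : x ^ p = 1 := by
    have := pow_card_eq_one' (x := (⟨x, hx⟩ : V))
    rw [hV] at this
    exact congrArg Subtype.val this
  have hmem : (⟨y, hy⟩ : V) ∈ Submonoid.powers (⟨x, hx⟩ : V) :=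
    mem_powers_of_prime_card hV (fun h => hx1 (congrArg Subtype.val h))
  obtain ⟨k, hk⟩ := hmem
  have hk' : x ^ k = y := congrArg Subtype.val hk
  have hpk : ¬ p ∣ k := by
    rintro ⟨m, rfl⟩
    rw [pow_mul, hxp, one_pow] at hk'
    exact hy1 hk'.symm
  obtain ⟨q, hq, hpq, hq4, hqk⟩ := exists_prime_modEq_one_four hp hodd hpk
  refine ⟨q, hq, hpq, hq4, ?_⟩
  rw [← hk']
  exact pow_eq_pow_iff_modEq.2 (hqk.of_dvd (orderOf_dvd_of_pow_eq_one hxp))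

/-- An S-ring over a group `⟨t⟩ × V` with `t ^ 2 = 1` and `|V| = p`, in which `{t}` is a basic set
and `V` is an `𝒜`-subgroup, is cyclotomic. -/
theorem SRing.isCyclotomic_of_involution_prime [Finite G] (A : SRing G) {p : ℕ} (hp : p.Prime)
    (hodd : Odd p) (hG : Nat.card G ∣ 4 * p ^ 2) {V : Subgroup G} (hVcard : Nat.card V = p)
    (hV : A.IsASubgroup V) {t : G} (ht : {t} ∈ A.basic) (ht2 : t ^ 2 = 1)
    (hcov : ∀ x, x ∈ V ∨ t * x ∈ V) : A.IsCyclotomic := by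
  have htt : ∀ x, t * (t * x) = x := fun x => by rw [← mul_assoc, ← sq, ht2, one_mul]
  have htq : ∀ q : ℕ, q ≡ 1 [MOD 4] → t ^ q = t := fun q hq =>
    pow_eq_self_of_modEq ht2 (hq.of_dvd (by norm_num))
  have hpow : ∀ x w : G, x ≠ 1 → x ≠ t → w ≠ 1 → w ≠ t → ∃ q, q.Prime ∧ p < q ∧
      q ≡ 1 [MOD 4] ∧ (x ^ q = w ∨ x ^ q = t * w) ∧ ((x ∈ V ↔ w ∈ V) → x ^ q = w) := by
    intro x w hx1 hxt hw1 hwt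
    have htne : ∀ z, z ≠ t → t * z ≠ 1 := by
      intro z hz h
      apply hz
      rw [← htt z, h, mul_one]
    by_cases hx : x ∈ V <;> by_cases hw : w ∈ V
    · obtain ⟨q, hq, hpq, hq4, h⟩ := exists_prime_pow_eq hp hodd hVcard hx hw hx1 hw1
      exact ⟨q, hq, hpq, hq4, Or.inl h, fun _ => h⟩
    · obtain ⟨q, hq, hpq, hq4, h⟩ := exists_prime_pow_eq hp hodd hVcard hx
        ((hcov w).resolve_left hw) hx1 (htne w hwt)
      exact ⟨q, hq, hpq, hq4, Or.inr h, fun hxw => absurd (hxw.1 hx) hw⟩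
    · obtain ⟨q, hq, hpq, hq4, h⟩ := exists_prime_pow_eq hp hodd hVcard
        ((hcov x).resolve_left hx) hw (htne x hxt) hw1
      rw [mul_pow, htq q hq4] at h
      exact ⟨q, hq, hpq, hq4, Or.inr (by rw [← h, htt]), fun hxw => absurd (hxw.2 hw) hx⟩
    · obtain ⟨q, hq, hpq, hq4, h⟩ := exists_prime_pow_eq hp hodd hVcard
        ((hcov x).resolve_left hx) ((hcov w).resolve_left hw) (htne x hxt) (htne w hwt)
      rw [mul_pow, htq q hq4] at h
      exact ⟨q, hq, hpq, hq4, Or.inl (mul_left_cancel h), fun _ => mul_left_cancel h⟩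
  let M : Subgroup (MulAut G) :=
    { carrier := {φ | ∀ Z ∈ A.basic, φ '' Z = Z}
      one_mem' := fun Z _ => by simp
      mul_mem' := by
        intro φ ψ hφ hψ Z hZ
        rw [MulAut.coe_mul, Set.image_comp, hψ Z hZ, hφ Z hZ]
      inv_mem' := by
        intro φ hφ Z hZ
        conv_lhs => rw [← hφ Z hZ]
        rw [← Set.image_comp, ← MulAut.coe_mul]
        simp }
  have horb : ∀ Z ∈ A.basic, ∀ x ∈ Z, (fun φ : MulAut G => φ x) '' (M : Set (MulAut G)) = Z := by
    intro Z hZ x hx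
    have hsingle : ∀ s, {s} ∈ A.basic → ∀ z ∈ Z, z = s → ∀ z' ∈ Z, z' = s := by
      rintro _ hs z hz rfl z' hz'
      rw [A.basic_eq hZ hs hz rfl] at hz'
      exact hz'
    ext y
    constructor
    · rintro ⟨φ, hφ, rfl⟩
      rw [← hφ Z hZ]
      exact ⟨x, hx, rfl⟩
    · intro hy
      by_cases hx1 : x = 1
      · exact ⟨1, M.one_mem, hx1.trans (hsingle 1 A.one_mem x hx hx1 y hy).symm⟩
      by_cases hxt : x = t
      · exact ⟨1, M.one_mem, hxt.trans (hsingle t ht x hx hxt y hy).symm⟩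
      have hy1 : y ≠ 1 := fun h => hx1 (hsingle 1 A.one_mem y hy h x hx)
      have hyt : y ≠ t := fun h => hxt (hsingle t ht y hy h x hx)
      have hxy : x ∈ V ↔ y ∈ V :=
        ⟨fun h => (A.isASet_iff _).1 hV Z hZ x hx h hy,
          fun h => (A.isASet_iff _).1 hV Z hZ y hy h hx⟩
      obtain ⟨q, hq, hpq, hq4, -, hxq⟩ := hpow x y hx1 hxt hy1 hyt
      have hxq := hxq hxy
      have hcop := coprime_of_dvd_four_mul_sq hp hG hq hpq hq4
      refine ⟨MulEquiv.ofBijective (powMonoidHom q) (powCoprime hcop).bijective, ?_, hxq⟩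
      intro W hW
      change (fun w => w ^ q) '' W = W
      obtain ⟨w, hw⟩ := A.nonempty W hW
      refine A.image_pow_eq hW hq hcop hw ?_
      by_cases hw1 : w = 1
      · rw [hw1] at hw ⊢
        simpa using hw
      by_cases hwt : w = t
      · rw [hwt] at hw ⊢
        rwa [htq q hq4]
      obtain ⟨s, hs, hps, hs4, hws, -⟩ := hpow w x hw1 hwt hx1 hxt
      have hscop := coprime_of_dvd_four_mul_sq hp hG hs hps hs4
      have hWs := SRing.isASet_image_pow (A.isASet_of_mem_basic hW) hs hscop
      have hwq : ∃ w' ∈ W, w' ^ s = (w ^ q) ^ s := by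
        rcases hws with hws | hws
        · obtain ⟨w', hw', h⟩ := (A.isASet_iff _).1 hWs Z hZ x hx ⟨w, hw, hws⟩ hy
          exact ⟨w', hw', by rw [pow_right_comm, hws, hxq]; exact h⟩
        · obtain ⟨w', hw', h⟩ := (A.isASet_iff _).1 hWs (t • Z) (SRing.smul_mem_basic ht hZ)
            (t * x) ⟨x, hx, rfl⟩ ⟨w, hw, hws⟩ (show t * y ∈ t • Z from ⟨y, hy, rfl⟩)
          exact ⟨w', hw', by rw [pow_right_comm, hws, mul_pow, hxq, htq q hq4]; exact h⟩
      obtain ⟨w', hw', h⟩ := hwq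
      rwa [← (powCoprime hscop).injective h]
  refine ⟨M, ?_⟩
  ext Z
  constructor
  · intro hZ
    obtain ⟨x, hx⟩ := A.nonempty Z hZ
    exact ⟨x, horb Z hZ x hx⟩
  · rintro ⟨x, rfl⟩
    obtain ⟨Z, ⟨hZ, hx⟩, -⟩ := A.cover x
    simpa only [horb Z hZ x hx] using hZ

end PrimePowers

section CyclicOfOrderFourP

variable {G : Type*} [CommGroup G]

theorem card_mul_relIndex_of_le {L U : Subgroup G} (hLU : L ≤ U) :
    Nat.card L * L.relIndex U = Nat.card U := by
  rw [← Subgroup.relIndex_bot_left L, Subgroup.relIndex_mul_relIndex ⊥ L U bot_le hLU,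
    Subgroup.relIndex_bot_left]

theorem card_mul_card_of_sup_inf {A B U : Subgroup G} (hsup : A ⊔ B = U)
    (hinf : A ⊓ B = ⊥) : Nat.card A * Nat.card B = Nat.card U := by
  rw [← card_mul_relIndex_of_le (hsup ▸ le_sup_left : A ≤ U), ← hsup,
    Subgroup.relIndex_sup_left, ← Subgroup.inf_relIndex_right, hinf, Subgroup.relIndex_bot_left]

/-- `U` is the direct product of `⟨c⟩ ≅ C₄` and a subgroup `P` of odd prime order `p`. -/
structure IsFourTimesPrime (p : ℕ) (c : G) (P U : Subgroup G) : Prop where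
  prime : p.Prime
  odd : Odd p
  orderOf_eq : orderOf c = 4
  card_eq : Nat.card P = p
  sup_eq : Subgroup.zpowers c ⊔ P = U
  inf_eq : Subgroup.zpowers c ⊓ P = ⊥

namespace IsFourTimesPrime

variable {p : ℕ} {c : G} {P U : Subgroup G}

theorem pow_four (h : IsFourTimesPrime p c P U) : c ^ 4 = 1 := by
  rw [← h.orderOf_eq, pow_orderOf_eq_one]

theorem mem_left (h : IsFourTimesPrime p c P U) : c ∈ U :=
  h.sup_eq ▸ Subgroup.mem_sup_left (Subgroup.mem_zpowers c)

theorem le_right (h : IsFourTimesPrime p c P U) : P ≤ U :=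
  h.sup_eq ▸ le_sup_right

theorem pow_mul_mem_iff (h : IsFourTimesPrime p c P U) {i : ℕ} {u : G} (hu : u ∈ P) :
    c ^ i * u ∈ P ↔ 4 ∣ i := by
  rw [Subgroup.mul_mem_cancel_right _ hu, ← h.orderOf_eq, orderOf_dvd_iff_pow_eq_one]
  constructor
  · intro hc
    have : c ^ i ∈ Subgroup.zpowers c ⊓ P := ⟨Subgroup.npow_mem_zpowers c i, hc⟩
    rwa [h.inf_eq, Subgroup.mem_bot] at this
  · intro hc
    rw [hc]
    exact P.one_mem

theorem exists_eq_pow_mul (h : IsFourTimesPrime p c P U) {x : G} (hx : x ∈ U) :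
    ∃ i < 4, ∃ u ∈ P, x = c ^ i * u := by
  rw [← h.sup_eq] at hx
  obtain ⟨a, ha, u, hu, rfl⟩ := Subgroup.mem_sup.1 hx
  have hfin : IsOfFinOrder c := by
    rw [← orderOf_pos_iff, h.orderOf_eq]
    norm_num
  classical
  rw [hfin.mem_zpowers_iff_mem_range_orderOf, h.orderOf_eq] at ha
  obtain ⟨i, hi, rfl⟩ := Finset.mem_image.1 ha
  exact ⟨i, Finset.mem_range.1 hi, u, hu, rfl⟩

theorem le_of_mem (h : IsFourTimesPrime p c P U) {L : Subgroup G} {u : G} (hu : u ∈ P)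
    (hu1 : u ≠ 1) (huL : u ∈ L) : P ≤ L := by
  intro x hx
  have := Fact.mk h.prime
  obtain ⟨k, hk⟩ := mem_zpowers_of_prime_card h.card_eq (g := ⟨u, hu⟩) (g' := ⟨x, hx⟩)
    (fun hu => hu1 (congrArg Subtype.val hu))
  rw [← show u ^ k = x from congrArg Subtype.val hk]
  exact L.zpow_mem huL k

theorem pow_prime (h : IsFourTimesPrime p c P U) {u : G} (hu : u ∈ P) : u ^ p = 1 := by
  have := pow_card_eq_one' (x := (⟨u, hu⟩ : P))
  rw [h.card_eq] at this
  exact congrArg Subtype.val this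

theorem exists_ne_one (h : IsFourTimesPrime p c P U) : ∃ u ∈ P, u ≠ 1 := by
  have : P ≠ ⊥ := by
    rintro rfl
    have := h.card_eq
    rw [Subgroup.card_bot] at this
    exact h.prime.one_lt.ne this
  simpa [Subgroup.eq_bot_iff_forall] using this

theorem coprime_four (h : IsFourTimesPrime p c P U) : Nat.Coprime 4 p :=
  Nat.Coprime.pow_left 2 (Nat.coprime_two_left.2 h.odd)

theorem pow_ne_one (h : IsFourTimesPrime p c P U) {u : G} (hu : u ∈ P) (hu1 : u ≠ 1) {k : ℕ}
    (hk : k ∣ 4) : u ^ k ≠ 1 := by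
  intro huk
  have h1 := orderOf_dvd_of_pow_eq_one (h.pow_prime hu)
  have h2 := (orderOf_dvd_of_pow_eq_one huk).trans hk
  exact hu1 (orderOf_eq_one_iff.1 (Nat.eq_one_of_dvd_coprimes h.coprime_four h2 h1))

theorem mem_zpowers_sq_iff (h : IsFourTimesPrime p c P U) {x : G} :
    x ∈ Subgroup.zpowers (c ^ 2) ↔ x = 1 ∨ x = c ^ 2 := by
  have h2 : orderOf (c ^ 2) = 2 := by
    rw [orderOf_pow_of_dvd two_ne_zero (by rw [h.orderOf_eq]; norm_num), h.orderOf_eq]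
  have hfin : IsOfFinOrder (c ^ 2) := by
    rw [← orderOf_pos_iff, h2]
    norm_num
  classical
  rw [hfin.mem_zpowers_iff_mem_range_orderOf, h2]
  simp [Finset.range_add_one, or_comm]

theorem pow_ne_one_of_not_dvd (h : IsFourTimesPrime p c P U) {i : ℕ} (hi : ¬ 4 ∣ i) :
    c ^ i ≠ 1 := by
  rwa [← h.orderOf_eq, orderOf_dvd_iff_pow_eq_one] at hi

theorem isCyclic (h : IsFourTimesPrime p c P U) (hU : Nat.card U = 4 * p) : IsCyclic U := by
  obtain ⟨u, hu, hu1⟩ := h.exists_ne_one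
  have hup : orderOf u = p :=
    (h.prime.eq_one_or_self_of_dvd _ (orderOf_dvd_of_pow_eq_one (h.pow_prime hu))).resolve_left
      (fun h1 => hu1 (orderOf_eq_one_iff.1 h1))
  have : Finite U := Nat.finite_of_card_ne_zero (by
    rw [hU]
    exact mul_ne_zero four_ne_zero h.prime.ne_zero)
  refine isCyclic_of_orderOf_eq_card (⟨c * u, U.mul_mem h.mem_left (h.le_right hu)⟩ : U) ?_
  rw [hU, Subgroup.orderOf_mk, (Commute.all c u).orderOf_mul_eq_mul_orderOf_of_coprime, hup,
    h.orderOf_eq]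
  rw [hup, h.orderOf_eq]
  exact h.coprime_four

/-- An element of the subgroup `⟨c²⟩ × P` of index two lies in `P` or in `c²P`. -/
theorem mem_or_mul_mem (h : IsFourTimesPrime p c P U) {x : G}
    (hx : x ∈ Subgroup.zpowers (c ^ 2) ⊔ P) : x ∈ P ∨ c ^ 2 * x ∈ P := by
  obtain ⟨a, ha, u, hu, rfl⟩ := Subgroup.mem_sup.1 hx
  rcases h.mem_zpowers_sq_iff.1 ha with rfl | rfl
  · left
    simpa using hu
  · right
    rwa [← mul_assoc, ← pow_add, h.pow_four, one_mul]

/-- An element of `U` outside `⟨c²⟩ × P` lies in `cP` or in `c³P`. -/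
theorem exists_of_not_mem (h : IsFourTimesPrime p c P U) {x : G} (hx : x ∈ U)
    (hxQ : x ∉ Subgroup.zpowers (c ^ 2) ⊔ P) : ∃ u ∈ P, x = c * u ∨ x = c ^ 3 * u := by
  obtain ⟨i, hi, u, hu, rfl⟩ := h.exists_eq_pow_mul hx
  interval_cases i
  · exact absurd (Subgroup.mem_sup_right (by simpa using hu)) hxQ
  · exact ⟨u, hu, Or.inl (by rw [pow_one])⟩
  · exact absurd (Subgroup.mul_mem_sup (Subgroup.mem_zpowers _) hu) hxQ
  · exact ⟨u, hu, Or.inr rfl⟩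

theorem not_mem_sup (h : IsFourTimesPrime p c P U) {u : G} (hu : u ∈ P) :
    c * u ∉ Subgroup.zpowers (c ^ 2) ⊔ P := by
  intro hx
  rcases h.mem_or_mul_mem hx with hx | hx
  · have := (h.pow_mul_mem_iff (i := 1) hu).1 (by simpa using hx)
    omega
  · have := (h.pow_mul_mem_iff (i := 3) hu).1 (by rwa [pow_succ, mul_assoc])
    omega

end IsFourTimesPrime

end CyclicOfOrderFourP

namespace IsFourTimesPrime

variable {G : Type*} [CommGroup G] [Finite G] {p : ℕ} {c : G} {P U : Subgroup G}

/-- If `⟨c⟩` is not an `𝒜`-subgroup, then the basic set of `c` contains `cP`. -/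
theorem mul_mem_basic (h : IsFourTimesPrime p c P U) (hG : Nat.card G ∣ 4 * p ^ 2) {A : SRing G}
    (hC : ¬ A.IsASubgroup (Subgroup.zpowers c)) {X : Set G} (hX : X ∈ A.basic) (hcX : c ∈ X)
    (hXU : X ⊆ U) {u : G} (hu : u ∈ P) : c * u ∈ X := by
  by_cases hu1 : u = 1
  · simpa [hu1] using hcX
  by_contra huX
  have hcP : ∀ v ∈ P, c * v ∈ X → v = 1 := by
    intro v hv hvX
    by_contra hv1
    obtain ⟨q, hq, hpq, hq4, hvq⟩ := exists_prime_pow_eq h.prime h.odd h.card_eq hv hu hv1 hu1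
    have hcq : c ^ q = c := pow_eq_self_of_modEq h.pow_four hq4
    have hXq := A.image_pow_eq hX hq (coprime_of_dvd_four_mul_sq h.prime hG hq hpq hq4) hcX
      (by rwa [hcq])
    apply huX
    rw [← hXq]
    exact ⟨_, hvX, by simp only [mul_pow, hcq, hvq]⟩
  have hD := SRing.isASet_pow (A.isASet_of_mem_basic hX) h.prime
  set D : Set G := {g | ¬ p ∣ {x | x ∈ X ∧ x ^ p = g}.ncard} with hDdef
  have hcD : c ^ p ∈ D := by
    have : {x | x ∈ X ∧ x ^ p = c ^ p} = {c} := by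
      ext x
      constructor
      · rintro ⟨hx, hxp⟩
        obtain ⟨i, hi, v, hv, rfl⟩ := h.exists_eq_pow_mul (hXU hx)
        rw [mul_pow, h.pow_prime hv, mul_one, ← pow_mul, pow_eq_pow_iff_modEq,
          h.orderOf_eq] at hxp
        have hi1 : i ≡ 1 [MOD 4] := by
          refine Nat.ModEq.cancel_right_of_coprime h.coprime_four ?_
          rwa [one_mul]
        have hi1 : i = 1 := Nat.ModEq.eq_of_lt_of_lt hi1 hi (by norm_num)
        rw [hi1, pow_one] at hx ⊢
        rw [hcP v hv hx, mul_one]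
        rfl
      · rintro rfl
        exact ⟨hcX, rfl⟩
    rw [hDdef, Set.mem_ofPred_eq, this, Set.ncard_singleton]
    exact h.prime.not_dvd_one
  have hDC : D ⊆ Subgroup.zpowers c := by
    intro g hg
    have hne : {x | x ∈ X ∧ x ^ p = g}.Nonempty := by
      rw [Set.nonempty_iff_ne_empty]
      intro h0
      simp [hDdef, h0] at hg
    obtain ⟨x, hx, rfl⟩ := hne
    obtain ⟨i, hi, v, hv, rfl⟩ := h.exists_eq_pow_mul (hXU hx)
    rw [mul_pow, h.pow_prime hv, mul_one, ← pow_mul]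
    exact Subgroup.npow_mem_zpowers c _
  apply hC
  have hclosure : Subgroup.closure D = Subgroup.zpowers c := by
    refine le_antisymm ((Subgroup.closure_le _).2 hDC) (Subgroup.zpowers_le.2 ?_)
    have hpp : c = (c ^ p) ^ p := by
      obtain ⟨m, hm⟩ := h.odd
      rw [← pow_mul, hm, show (2 * m + 1) * (2 * m + 1) = 4 * (m ^ 2 + m) + 1 by ring, pow_succ,
        pow_mul, h.pow_four, one_pow, one_mul]
    rw [hpp]
    exact Subgroup.pow_mem _ (Subgroup.subset_closure hcD) p
  rw [← hclosure]
  exact SRing.isASubgroup_closure hD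

theorem isASubgroup_sup (h : IsFourTimesPrime p c P U) (hG : Nat.card G ∣ 4 * p ^ 2)
    {A : SRing G} (hC : ¬ A.IsASubgroup (Subgroup.zpowers c)) {X : Set G} (hX : X ∈ A.basic)
    (hcX : c ∈ X) (hXU : X ⊆ U) (hker : ∀ x : G, x ^ 2 = 1 ↔ x = 1 ∨ x = c ^ 2)
    (hc2 : {c ^ 2} ∈ A.basic) {Y : Set G} (hY : Y ∈ A.basic) (hYU : Y ⊆ U) {y : G} (hy : y ∈ Y)
    (hcy : c ^ 2 * y ∉ Y) (hyC : y ∉ Subgroup.zpowers (c ^ 2)) :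
    A.IsASubgroup (Subgroup.zpowers (c ^ 2) ⊔ P) := by
  have hD := SRing.isASet_sq (A.isASet_of_mem_basic hY)
    (h.pow_ne_one_of_not_dvd (i := 2) (by norm_num)) hker
  set D : Set G := {g | ∃ y ∈ Y, c ^ 2 * y ∉ Y ∧ y ^ 2 = g} with hDdef
  have hDQ : D ⊆ (Subgroup.zpowers (c ^ 2) ⊔ P : Subgroup G) := by
    rintro _ ⟨z, hz, -, rfl⟩
    obtain ⟨i, -, u, hu, rfl⟩ := h.exists_eq_pow_mul (hYU hz)
    rw [mul_pow, pow_right_comm]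
    exact Subgroup.mul_mem_sup (Subgroup.npow_mem_zpowers _ i) (P.pow_mem hu 2)
  have hXc := fun u (hu : u ∈ P) => h.mul_mem_basic hG hC hX hcX hXU hu
  have hXc' : ∀ u ∈ P, c ^ 3 * u ∈ X⁻¹ := by
    intro u hu
    have : (c ^ 3 * u)⁻¹ = c * u⁻¹ := by
      rw [mul_inv, inv_eq_of_mul_eq_one_left (a := c) (by rw [← pow_succ', h.pow_four])]
    rw [Set.mem_inv, this]
    exact hXc _ (P.inv_mem hu)
  have hfour : ∀ u, c ^ 2 * (c ^ 3 * u) = c * u := fun u => by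
    rw [← mul_assoc, ← pow_add, show 2 + 3 = 4 + 1 by rfl, pow_add, h.pow_four, one_mul, pow_one]
  have hthree : ∀ u, c ^ 2 * (c * u) = c ^ 3 * u := fun u => by rw [← mul_assoc, ← pow_succ]
  have hXinv := A.inv_mem X hX
  have hDmem : ∃ i, ∃ u ∈ P, u ≠ 1 ∧ (c ^ 2) ^ i * u ^ 2 ∈ D := by
    obtain ⟨v, hv, hv1⟩ := h.exists_ne_one
    have hodd : X ≠ X⁻¹ → ∀ z : G, (z = c * v ∧ Y = X) ∨ (z = c ^ 3 * v ∧ Y = X⁻¹) →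
        z ∈ Y ∧ c ^ 2 * z ∉ Y := by
      rintro hne z (⟨rfl, rfl⟩ | ⟨rfl, rfl⟩)
      · refine ⟨hXc v hv, fun hmem => hne ?_⟩
        rw [hthree] at hmem
        exact A.basic_eq hX hXinv hmem (hXc' v hv)
      · refine ⟨hXc' v hv, fun hmem => hne ?_⟩
        rw [hfour] at hmem
        exact A.basic_eq hX hXinv (hXc v hv) hmem
    obtain ⟨i, hi, u, hu, rfl⟩ := h.exists_eq_pow_mul (hYU hy)
    interval_cases i
    · refine ⟨0, u, hu, ?_, _, hy, hcy, by simp⟩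
      rintro rfl
      exact hyC (by simp)
    · rw [pow_one] at hy hcy
      have hYX := A.basic_eq hY hX hy (hXc u hu)
      have hne : X ≠ X⁻¹ := by
        rintro heq
        apply hcy
        rw [hthree, hYX, heq]
        exact hXc' u hu
      obtain ⟨h1, h2⟩ := hodd hne (c * v) (Or.inl ⟨rfl, hYX⟩)
      exact ⟨1, v, hv, hv1, _, h1, h2, by rw [mul_pow, pow_one]⟩
    · refine ⟨2, u, hu, ?_, _, hy, hcy, by rw [mul_pow]⟩
      rintro rfl
      exact hyC (by simp)
    · have hYX := A.basic_eq hY hXinv hy (hXc' u hu)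
      have hne : X ≠ X⁻¹ := by
        rintro heq
        apply hcy
        rw [hfour, hYX, ← heq]
        exact hXc u hu
      obtain ⟨h1, h2⟩ := hodd hne (c ^ 3 * v) (Or.inr ⟨rfl, hYX⟩)
      exact ⟨3, v, hv, hv1, _, h1, h2, by rw [mul_pow, pow_right_comm]⟩
  obtain ⟨i, u, hu, hu1, hiu⟩ := hDmem
  have hclosure : Subgroup.closure (D ∪ {c ^ 2}) = Subgroup.zpowers (c ^ 2) ⊔ P := by
    refine le_antisymm ((Subgroup.closure_le _).2 ?_) (sup_le ?_ ?_)
    · refine Set.union_subset hDQ ?_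
      rintro _ rfl
      exact Subgroup.mem_sup_left (Subgroup.mem_zpowers _)
    · exact Subgroup.zpowers_le.2 (Subgroup.subset_closure (Or.inr rfl))
    · refine h.le_of_mem (P.pow_mem hu 2) (h.pow_ne_one hu hu1 (by norm_num)) ?_
      have hc : c ^ 2 ∈ Subgroup.closure (D ∪ {c ^ 2}) := Subgroup.subset_closure (Or.inr rfl)
      exact (Subgroup.mul_mem_cancel_left _ (Subgroup.pow_mem _ hc i)).1
        (Subgroup.subset_closure (Or.inl hiu))
  rw [← hclosure]
  exact SRing.isASubgroup_closure (hD.union (A.isASet_of_mem_basic hc2))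

/-- If `{c²}` is not a basic set, then the `𝒜`-subgroup generated by `c²` has index at most two
in `U`. -/
theorem exists_relIndex_le_two (h : IsFourTimesPrime p c P U) (hU : Nat.card U = 4 * p)
    {A : SRing G} (hUA : A.IsASubgroup U) (hC : ¬ A.IsASubgroup (Subgroup.zpowers c))
    (hc2 : {c ^ 2} ∉ A.basic) : ∃ T ∈ A.basic, c ^ 2 ∈ T ∧ Subgroup.closure T ≤ U ∧
      (Subgroup.closure T).relIndex U ≤ 2 := by
  obtain ⟨T, ⟨hT, hcT⟩, -⟩ := A.cover (c ^ 2)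
  have hTU : T ⊆ U := (A.isASet_iff _).1 hUA T hT _ hcT (U.pow_mem h.mem_left 2)
  have hLU := (Subgroup.closure_le U).2 hTU
  have hc2L : c ^ 2 ∈ Subgroup.closure T := Subgroup.subset_closure hcT
  refine ⟨T, hT, hcT, hLU, ?_⟩
  have hTC : ¬ T ⊆ Subgroup.zpowers c := by
    intro hsub
    have hcL : c ∉ Subgroup.closure T := by
      intro hcL
      apply hC
      rw [le_antisymm (Subgroup.zpowers_le.2 hcL) ((Subgroup.closure_le _).2 hsub)]
      exact SRing.isASubgroup_closure (A.isASet_of_mem_basic hT)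
    apply hc2
    convert hT using 1
    refine (Set.eq_singleton_iff_unique_mem.2 ⟨hcT, fun x hx => ?_⟩).symm
    have h1 : x ≠ 1 := by
      rintro rfl
      have := A.basic_eq hT A.one_mem hx rfl ▸ hcT
      exact h.pow_ne_one_of_not_dvd (i := 2) (by norm_num) this
    obtain ⟨i, hi, u, hu, rfl⟩ := h.exists_eq_pow_mul (hTU hx)
    have hu1 : u = 1 := by
      have huC := (Subgroup.mul_mem_cancel_left _ (Subgroup.npow_mem_zpowers c i)).1 (hsub hx)
      have : u ∈ Subgroup.zpowers c ⊓ P := ⟨huC, hu⟩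
      rwa [h.inf_eq, Subgroup.mem_bot] at this
    rw [hu1, mul_one] at hx h1 ⊢
    interval_cases i
    · exact absurd (pow_zero c) h1
    · exact absurd (Subgroup.subset_closure (by simpa using hx)) hcL
    · rfl
    · refine absurd ?_ hcL
      have := (Subgroup.closure T).mul_mem hc2L (Subgroup.subset_closure hx)
      rwa [← pow_add, show 2 + 3 = 4 + 1 by rfl, pow_add, h.pow_four, one_mul, pow_one] at this
  obtain ⟨x, hx, hxC⟩ := Set.not_subset.1 hTC
  obtain ⟨i, -, u, hu, rfl⟩ := h.exists_eq_pow_mul (hTU hx)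
  have hu1 : u ≠ 1 := by
    rintro rfl
    exact hxC (by simp)
  have hPL : P ≤ Subgroup.closure T := by
    refine h.le_of_mem (P.pow_mem hu 4) (h.pow_ne_one hu hu1 dvd_rfl) ?_
    have := Subgroup.pow_mem _ (Subgroup.subset_closure hx) 4
    rwa [mul_pow, pow_right_comm, h.pow_four, one_pow, one_mul] at this
  have hp_dvd : p ∣ Nat.card (Subgroup.closure T) :=
    h.card_eq ▸ Subgroup.card_dvd_of_le hPL
  have h2_dvd : 2 ∣ Nat.card (Subgroup.closure T) := by
    have h2 : orderOf (c ^ 2) = 2 := by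
      rw [orderOf_pow_of_dvd two_ne_zero (by rw [h.orderOf_eq]; norm_num), h.orderOf_eq]
    rw [← h2]
    exact Subgroup.orderOf_dvd_natCard _ hc2L
  obtain ⟨m, hm⟩ := (Nat.coprime_two_left.2 h.odd).mul_dvd_of_dvd_of_dvd h2_dvd hp_dvd
  have hmul := (mul_comm _ _).trans (card_mul_relIndex_of_le hLU)
  rw [hU, hm] at hmul
  refine Nat.le_of_dvd two_pos ⟨m, ?_⟩
  have : 2 * p * ((Subgroup.closure T).relIndex U * m) = 2 * p * 2 := by linarith
  exact (Nat.eq_of_mul_eq_mul_left (Nat.mul_pos two_pos h.prime.pos) this).symm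

theorem condCA'_of_isASubgroup (h : IsFourTimesPrime p c P U) (hU : Nat.card U = 4 * p)
    (hG : Nat.card G ∣ 4 * p ^ 2) {A : SRing G} (hc2 : {c ^ 2} ∈ A.basic)
    (hP : A.IsASubgroup P) :
    CondCA' A (Subgroup.zpowers (c ^ 2) ⊔ P) (Subgroup.zpowers (c ^ 2)) := by
  set Q := Subgroup.zpowers (c ^ 2) ⊔ P with hQ
  have hQU : Q ≤ U := sup_le (Subgroup.zpowers_le.2 (U.pow_mem h.mem_left 2)) h.le_right
  have := h.isCyclic hU
  have : IsCyclic Q := isCyclic_of_injective _ (Subgroup.inclusion_injective hQU)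
  refine ⟨Or.inl fun AU hAU => ?_, fun AS _ => ?_⟩
  · have hcQ : c ^ 2 ∈ Q := Subgroup.mem_sup_left (Subgroup.mem_zpowers _)
    refine AU.isCyclotomic_of_involution_prime (V := P.subgroupOf Q) (t := ⟨c ^ 2, hcQ⟩)
      h.prime h.odd ((Subgroup.card_subgroup_dvd_card Q).trans hG) ?_
      (SRing.isASet_preimage_val hAU hP) ?_ ?_ fun x => h.mem_or_mul_mem x.2
    · rw [Nat.card_congr (Subgroup.subgroupOfEquivOfLe le_sup_right).toEquiv, h.card_eq]
    · rw [hAU]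
      simpa [restrictBasic] using hc2
    · ext
      simp [← pow_mul, h.pow_four]
  · have : IsCyclic (Q ⧸ (Subgroup.zpowers (c ^ 2)).subgroupOf Q) :=
      isCyclic_of_surjective _ (QuotientGroup.mk'_surjective _)
    exact AS.isCayleyMinimal_of_isCyclic

theorem condCA''_of_smul_mem_basic (h : IsFourTimesPrime p c P U) (hU : Nat.card U = 4 * p)
    {A : SRing G} (hc2 : {c ^ 2} ∈ A.basic) (hcP : c • (P : Set G) ∈ A.basic) :
    CondCA'' p A U (Subgroup.zpowers (c ^ 2)) := by
  have hinv : c⁻¹ = c ^ 3 := inv_eq_of_mul_eq_one_right (by rw [← pow_succ', h.pow_four])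
  have hcP' : c ^ 3 • (P : Set G) ∈ A.basic := by
    convert A.inv_mem _ hcP using 1
    rw [← hinv, ← Set.singleton_smul, ← Set.singleton_smul, smul_eq_mul, smul_eq_mul, mul_inv,
      Set.inv_singleton, inv_coe_set]
  have hPA : A.IsASubgroup P := by
    have := (A.isASet_of_mem_basic hcP).mul (A.isASet_of_mem_basic hcP')
    rwa [smul_mul_smul_comm, ← pow_succ', h.pow_four, one_smul, coe_mul_coe] at this
  refine ⟨hU, h.isCyclic hU, ?_, fun AU hAU => ⟨P.subgroupOf U,
    SRing.isASet_preimage_val hAU hPA, ?_, ?_⟩⟩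
  · rw [Nat.card_zpowers, orderOf_pow_of_dvd two_ne_zero (by rw [h.orderOf_eq]; norm_num),
      h.orderOf_eq]
  · rw [Nat.card_congr (Subgroup.subgroupOfEquivOfLe h.le_right).toEquiv, h.card_eq]
  · refine AU.basic_eq_tensorWreathBasic ?_ (SRing.isASet_preimage_val hAU hPA) ?_
    · intro l hl
      rw [hAU, restrictBasic, Set.mem_ofPred_eq, Set.image_singleton]
      rcases h.mem_zpowers_sq_iff.1 (show (l : G) ∈ _ from hl) with h1 | h1 <;> rw [h1]
      · exact A.one_mem
      · exact hc2
    · intro x hx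
      have hxQ : (x : G) ∉ Subgroup.zpowers (c ^ 2) ⊔ P := by
        intro hxQ
        apply hx
        obtain ⟨a, ha, u, hu, hau⟩ := Subgroup.mem_sup.1 hxQ
        have haU : a ∈ U := by
          rw [← Subgroup.mul_mem_cancel_right _ (h.le_right hu), hau]
          exact x.2
        rw [show x = ⟨a, haU⟩ * ⟨u, h.le_right hu⟩ from Subtype.ext hau.symm]
        exact Subgroup.mul_mem_sup ha hu
      have himage : Subtype.val '' (x • ((P.subgroupOf U : Subgroup U) : Set U))
          = (x : G) • (P : Set G) := by
        ext g
        constructor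
        · rintro ⟨_, ⟨v, hv, rfl⟩, rfl⟩
          exact ⟨v, hv, rfl⟩
        · rintro ⟨v, hv, rfl⟩
          exact ⟨_, ⟨⟨v, h.le_right hv⟩, hv, rfl⟩, rfl⟩
      rw [hAU, restrictBasic, Set.mem_ofPred_eq, himage]
      obtain ⟨u, hu, hxu | hxu⟩ := h.exists_of_not_mem x.2 hxQ
      · rwa [hxu, mul_smul, smul_coe_set hu]
      · rwa [hxu, mul_smul, smul_coe_set hu]

end IsFourTimesPrime

/-- Suppose `C = ⟨c⟩` is not an `𝒜`-subgroup, `X` is the basic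
set of `𝒜` containing `c`, `U = ⟨X⟩`, `|U| = 4p`, and `C₁ ≤ rad(Y)` for every basic
set `Y` of `𝒜` outside `U`. Then `𝒜` is a nontrivial `S' = U'/L'`-wreath product
satisfying one of (CA), (CA'), (CA''). -/
theorem stmt18 (p : ℕ) (hp : p.Prime) (hodd : Odd p)
    (G : Type*) [CommGroup G] [Finite G] (C H : Subgroup G)
    (hC : Nonempty (↥C ≃* Multiplicative (ZMod 4)))
    (hH : Nonempty (↥H ≃* Multiplicative (ZMod p) × Multiplicative (ZMod p)))
    (hinf : C ⊓ H = ⊥) (hsup : C ⊔ H = ⊤)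
    (K : Subgroup (Equiv.Perm G)) (hK : InSup2Min K)
    (A : SRing G) (hA : A.basic = VBasic K)
    (c : G) (hc : Subgroup.zpowers c = C) (hc4 : orderOf c = 4)
    (hCA : ¬ A.IsASubgroup C)
    (X : Set G) (hX : X ∈ A.basic) (hcX : c ∈ X)
    (hU : Nat.card ↥(Subgroup.closure X) = 4 * p)
    (hrad : ∀ Y ∈ A.basic, ¬ Y ⊆ (Subgroup.closure X : Set G) →
      (Subgroup.zpowers (c ^ 2) : Set G) ⊆ rad Y) :
    WreathConclusion p A := by
  subst hc
  have hCcard : Nat.card (Subgroup.zpowers c) = 4 := by rw [Nat.card_zpowers, hc4]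
  have hHcard : Nat.card H = p ^ 2 := by
    rw [Nat.card_congr hH.some.toEquiv, Nat.card_prod, Nat.card_congr Multiplicative.toAdd,
      Nat.card_zmod, sq]
  have hHp : ∀ x ∈ H, x ^ p = 1 := by
    intro x hx
    have : (⟨x, hx⟩ : H) ^ p = 1 := by
      apply hH.some.injective
      rw [map_pow, map_one]
      ext <;> simp
    exact congrArg Subtype.val this
  have hGcard : Nat.card G = 4 * p ^ 2 := by
    rw [← (Subgroup.isComplement'_of_disjoint_and_mul_eq_univ (disjoint_iff.2 hinf) (by
      rw [← Subgroup.mul_normal, hsup, Subgroup.coe_top])).card_mul_card, hCcard, hHcard]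
  have hXU : X ⊆ (Subgroup.closure X : Set G) := Subgroup.subset_closure
  have hUA : A.IsASubgroup (Subgroup.closure X) :=
    SRing.isASubgroup_closure (A.isASet_of_mem_basic hX)
  set U := Subgroup.closure X with hUdef
  have hcU : c ∈ U := hXU hcX
  set P := U ⊓ H with hPdef
  have hsupP : Subgroup.zpowers c ⊔ P = U := by
    refine le_antisymm (sup_le (Subgroup.zpowers_le.2 hcU) inf_le_left) fun x hx => ?_
    obtain ⟨a, ha, y, hy, rfl⟩ := Subgroup.mem_sup.1 (hsup ▸ Subgroup.mem_top x)
    have haU : a ∈ U := Subgroup.zpowers_le.2 hcU ha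
    exact Subgroup.mul_mem_sup ha ⟨(Subgroup.mul_mem_cancel_left _ haU).1 hx, hy⟩
  have hinfP : Subgroup.zpowers c ⊓ P = ⊥ :=
    eq_bot_iff.2 (hinf ▸ inf_le_inf_left _ inf_le_right)
  have hPcard : Nat.card P = p := by
    have h1 := card_mul_card_of_sup_inf hsupP hinfP
    rw [hCcard, hU] at h1
    exact Nat.eq_of_mul_eq_mul_left four_pos h1
  have h : IsFourTimesPrime p c P U := ⟨hp, hodd, hc4, hPcard, hsupP, hinfP⟩
  have hker : ∀ x : G, x ^ 2 = 1 ↔ x = 1 ∨ x = c ^ 2 := by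
    intro x
    constructor
    · intro hx
      obtain ⟨a, ha, y, hy, rfl⟩ := Subgroup.mem_sup.1 (hsup ▸ Subgroup.mem_top x)
      have hy1 : y = 1 := by
        have h2 : a ^ 2 * y ^ 2 = 1 := by rwa [← mul_pow]
        have h3 : y ^ 2 ∈ Subgroup.zpowers c ⊓ H := by
          refine ⟨?_, H.pow_mem hy 2⟩
          rw [eq_inv_of_mul_eq_one_right h2]
          exact Subgroup.inv_mem _ (Subgroup.pow_mem _ ha 2)
        rw [hinf, Subgroup.mem_bot] at h3
        exact orderOf_eq_one_iff.1 (Nat.eq_one_of_dvd_coprimes (Nat.coprime_two_left.2 hodd)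
          (orderOf_dvd_of_pow_eq_one h3) (orderOf_dvd_of_pow_eq_one (hHp y hy)))
      rw [hy1, mul_one] at hx ⊢
      obtain ⟨i, hi, u, hu, rfl⟩ := h.exists_eq_pow_mul (Subgroup.zpowers_le.2 hcU ha)
      have hu1 : u = 1 := by
        have : u ∈ Subgroup.zpowers c ⊓ P :=
          ⟨(Subgroup.mul_mem_cancel_left _ (Subgroup.npow_mem_zpowers c i)).1 ha, hu⟩
        rwa [hinfP, Subgroup.mem_bot] at this
      rw [hu1, mul_one, ← pow_mul, ← orderOf_dvd_iff_pow_eq_one, hc4] at hx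
      rw [hu1, mul_one]
      interval_cases i
      · exact Or.inl (pow_zero c)
      · omega
      · exact Or.inr rfl
      · omega
    · rintro (rfl | rfl)
      · exact one_pow 2
      · rw [← pow_mul, h.pow_four]
  have hc2ne : c ^ 2 ≠ 1 := h.pow_ne_one_of_not_dvd (by norm_num)
  have hC₁ne : Subgroup.zpowers (c ^ 2) ≠ ⊥ := by rwa [Ne, Subgroup.zpowers_eq_bot]
  have hUtop : U ≠ ⊤ := by
    intro htop
    rw [htop, Subgroup.card_top, hGcard] at hU
    nlinarith [hp.one_lt, sq p]
  by_cases hc2 : {c ^ 2} ∈ A.basic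
  swap
  · obtain ⟨T, hT, hcT, hTU, hrel⟩ := h.exists_relIndex_le_two hU hUA hCA hc2
    refine ⟨U, Subgroup.closure T, hTU, hUA,
      SRing.isASubgroup_closure (A.isASet_of_mem_basic hT), fun hbot => hc2ne ?_, hUtop,
      fun Y hY hYU => ?_, Or.inl (condCA_of_relIndex_le_two A hrel)⟩
    · rw [← Subgroup.mem_bot, ← hbot]
      exact Subgroup.subset_closure hcT
    · have hsub := (A.isASet_iff _).1 (A.isASet_rad hY) T hT _ hcT
        (hrad Y hY hYU (Subgroup.mem_zpowers _))
      rw [rad_eq_stabilizer] at hsub ⊢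
      exact (Subgroup.closure_le _).2 hsub
  have hC₁A : A.IsASubgroup (Subgroup.zpowers (c ^ 2)) := by
    rw [Subgroup.zpowers_eq_closure]
    exact SRing.isASubgroup_closure (A.isASet_of_mem_basic hc2)
  have hcQ : c ∉ Subgroup.zpowers (c ^ 2) ⊔ P := by simpa using h.not_mem_sup P.one_mem
  by_cases hY : ∃ Y ∈ A.basic, ∃ y ∈ Y, c ^ 2 * y ∉ Y ∧ y ∉ Subgroup.zpowers (c ^ 2)
  swap
  · push Not at hY
    refine ⟨_, _, le_rfl, hC₁A, hC₁A, hC₁ne, fun htop => ?_, fun Z hZ hZC => ?_,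
      Or.inl (condCA_of_relIndex_le_two A (by simp))⟩
    · exact hcQ (Subgroup.mem_sup_left (htop ▸ Subgroup.mem_top c))
    · refine zpowers_subset_rad fun z hz => ?_
      by_contra hcz
      exact hZC ((A.isASet_iff _).1 hC₁A Z hZ z hz (hY Z hZ z hz hcz))
  obtain ⟨Y, hY, y, hy, hcy, hyC⟩ := hY
  have hYU : Y ⊆ U := by
    by_contra hYU
    have := hrad Y hY hYU (Subgroup.mem_zpowers _)
    rw [rad_eq_stabilizer, SetLike.mem_coe, MulAction.mem_stabilizer_iff] at this
    exact hcy (this ▸ Set.smul_mem_smul_set hy)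
  have hG : Nat.card G ∣ 4 * p ^ 2 := hGcard.dvd
  have hQA := h.isASubgroup_sup hG hCA hX hcX hXU hker hc2 hY hYU hy hcy hyC
  have hcP : ∀ u ∈ P, c * u ∈ X := fun u hu => h.mul_mem_basic hG hCA hX hcX hXU hu
  have hXQ : ∀ x ∈ X, x ∉ Subgroup.zpowers (c ^ 2) ⊔ P := fun x hx hxQ =>
    hcQ ((A.isASet_iff _).1 hQA X hX x hx hxQ hcX)
  have hinv : ∀ u, (c ^ 3 * u)⁻¹ = c * u⁻¹ := fun u => by
    rw [mul_inv, inv_eq_of_mul_eq_one_left (a := c) (by rw [← pow_succ', h.pow_four])]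
  have hcP' : ∀ u ∈ P, c ^ 3 * u ∈ X⁻¹ := fun u hu => by
    rw [Set.mem_inv, hinv]
    exact hcP _ (P.inv_mem hu)
  by_cases hXX : X = X⁻¹
  swap
  · have hXeq : X = c • (P : Set G) := by
      ext x
      constructor
      · intro hx
        obtain ⟨u, hu, rfl | rfl⟩ := h.exists_of_not_mem (hXU hx) (hXQ x hx)
        · exact ⟨u, hu, rfl⟩
        · exact absurd (A.basic_eq hX (A.inv_mem X hX) hx (hcP' u hu)) hXX
      · rintro ⟨u, hu, rfl⟩
        exact hcP u hu
    exact ⟨U, _, Subgroup.zpowers_le.2 (U.pow_mem hcU 2), hUA, hC₁A, hC₁ne, hUtop, hrad,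
      Or.inr (Or.inr (h.condCA''_of_smul_mem_basic hU hc2 (hXeq ▸ hX)))⟩
  have houtX : ∀ x ∈ U, x ∉ Subgroup.zpowers (c ^ 2) ⊔ P → x ∈ X := by
    intro x hx hxQ
    obtain ⟨u, hu, rfl | rfl⟩ := h.exists_of_not_mem hx hxQ
    · exact hcP u hu
    · exact hXX ▸ hcP' u hu
  have hXmul : ∀ x ∈ X, c ^ 2 * x ∈ X := by
    intro x hx
    refine houtX _ (U.mul_mem (U.pow_mem hcU 2) (hXU hx)) fun hmem => hXQ x hx ?_
    exact (Subgroup.mul_mem_cancel_left _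
      (Subgroup.mem_sup_left (Subgroup.mem_zpowers _))).1 hmem
  have hYQ : Y ⊆ (Subgroup.zpowers (c ^ 2) ⊔ P : Subgroup G) := by
    intro z hz
    by_contra hzQ
    have := A.basic_eq hY hX hz (houtX z (hYU hz) hzQ)
    exact hcy (this ▸ hXmul y (this ▸ hy))
  have hPA : A.IsASubgroup P := by
    have hsq : ∀ z ∈ Y, ∃ u ∈ P, z ^ 2 = u ^ 2 ∧ (z = u ∨ c ^ 2 * z = u) := by
      intro z hz
      rcases h.mem_or_mul_mem (hYQ hz) with hzP | hzP
      · exact ⟨z, hzP, rfl, Or.inl rfl⟩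
      · refine ⟨_, hzP, ?_, Or.inr rfl⟩
        rw [mul_pow, (hker (c ^ 2)).2 (Or.inr rfl), one_mul]
    have hD := SRing.isASet_sq (A.isASet_of_mem_basic hY) hc2ne hker
    suffices heq : Subgroup.closure {g | ∃ y ∈ Y, c ^ 2 * y ∉ Y ∧ y ^ 2 = g} = P by
      rw [← heq]
      exact SRing.isASubgroup_closure hD
    refine le_antisymm ((Subgroup.closure_le _).2 ?_) ?_
    · rintro _ ⟨z, hz, -, rfl⟩
      obtain ⟨u, hu, hzu, -⟩ := hsq z hz
      rw [hzu]
      exact P.pow_mem hu 2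
    · obtain ⟨u, hu, hyu, hor⟩ := hsq y hy
      have hu1 : u ≠ 1 := by
        rintro rfl
        apply hyC
        rcases hor with hor | hor
        · rw [hor]
          exact Subgroup.one_mem _
        · rw [eq_inv_of_mul_eq_one_right hor]
          exact Subgroup.inv_mem _ (Subgroup.mem_zpowers _)
      refine h.le_of_mem (P.pow_mem hu 2) (h.pow_ne_one hu hu1 (by norm_num)) ?_
      exact Subgroup.subset_closure ⟨y, hy, hcy, hyu⟩
  refine ⟨_, _, le_sup_left, hQA, hC₁A, hC₁ne, fun htop => hcQ (htop ▸ Subgroup.mem_top c),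
    fun Z hZ hZQ => ?_, Or.inr (Or.inl (h.condCA'_of_isASubgroup hU hG hc2 hPA))⟩
  by_cases hZU : Z ⊆ U
  · obtain ⟨z, hz, hzQ⟩ := Set.not_subset.1 hZQ
    rw [A.basic_eq hZ hX hz (houtX z (hZU hz) hzQ)]
    exact zpowers_subset_rad hXmul
  · exact hrad Z hZ hZU

end Paper
end
end

section
/- Let p be an odd prime, G = C × H where C = ⟨c⟩ ≅ C₄ and H ≅ C_p × C_p. Let K ∈ Sup₂^min(G_r) and 𝒜 = V(K,G). Suppose that C is not an 𝒜-subgroup, H is an 𝒜-subgroup, the basic set X of 𝒜 containing c has the form X = Lc for an 𝒜-subgroup L with |L| ∈ {p, 2p}, and put L₁ = L ∩ H (so L₁ is an 𝒜-subgroup of order p). Then the quotient S-ring 𝒜_{G/L₁} is cyclotomic. -/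
open scoped Pointwise

noncomputable section

namespace Paper

namespace SRing

/-- Two elements are equivalent if they lie in the same basic set. -/
def Eqv {G : Type*} [Group G] [Finite G] (A : SRing G) (x y : G) : Prop :=
  ∃ X ∈ A.basic, x ∈ X ∧ y ∈ X

section Basic

variable {G : Type*} [Group G] [Finite G] (A : SRing G)

theorem Eqv.refl (x : G) : A.Eqv x x := by
  obtain ⟨X, ⟨hX, hx⟩, -⟩ := A.cover x
  exact ⟨X, hX, hx, hx⟩

variable {A}

theorem Eqv.symm {x y : G} : A.Eqv x y → A.Eqv y x :=
  fun ⟨X, hX, hx, hy⟩ => ⟨X, hX, hy, hx⟩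

theorem mem_of_eqv {x y : G} (h : A.Eqv x y) {X : Set G} (hX : X ∈ A.basic) (hx : x ∈ X) :
    y ∈ X := by
  obtain ⟨Y, hY, hxY, hyY⟩ := h
  rwa [(A.cover x).unique ⟨hX, hx⟩ ⟨hY, hxY⟩]

theorem Eqv.trans {x y z : G} (h : A.Eqv x y) (h' : A.Eqv y z) : A.Eqv x z := by
  obtain ⟨X, hX, hx, hy⟩ := h
  exact ⟨X, hX, hx, mem_of_eqv h' hX hy⟩

theorem Eqv.inv {x y : G} (h : A.Eqv x y) : A.Eqv x⁻¹ y⁻¹ := by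
  obtain ⟨X, hX, hx, hy⟩ := h
  exact ⟨X⁻¹, A.inv_mem X hX, by simpa using hx, by simpa using hy⟩

theorem Eqv.eq_one {x : G} (h : A.Eqv 1 x) : x = 1 :=
  mem_of_eqv h A.one_mem rfl

open scoped Classical in
theorem coeff_sumElems (X : Set G) (g : G) :
    (sumElems X).coeff g = if g ∈ X then 1 else 0 := by
  simp [sumElems, Finsupp.single_apply]

theorem Eqv.coeff_eq {x y : G} (h : A.Eqv x y) {f : MonoidAlgebra ℤ G} (hf : f ∈ A.span) :
    f.coeff x = f.coeff y := by
  classical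
  induction hf using Submodule.span_induction with
  | mem f hf =>
    obtain ⟨X, hX, rfl⟩ := hf
    have : x ∈ X ↔ y ∈ X := ⟨mem_of_eqv h hX, mem_of_eqv h.symm hX⟩
    simp only [coeff_sumElems, this]
  | zero => simp
  | add f g _ _ hf hg => simp [hf, hg]
  | smul a f _ hf => simp only [MonoidAlgebra.coeff_smul_apply, hf]

theorem IsASubgroup.mem_of_eqv {H : Subgroup G} (hH : A.IsASubgroup H) {x y : G}
    (h : A.Eqv x y) (hx : x ∈ H) : y ∈ H := by
  classical
  have := h.coeff_eq hH
  by_contra hy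
  simp [coeff_sumElems, hx, hy] at this

theorem sumElems_mem_span {X : Set G} (hX : X ∈ A.basic) : sumElems X ∈ A.span :=
  Submodule.subset_span ⟨X, hX, rfl⟩

open scoped Classical in
theorem coeff_sumElems_mul (X Y : Set G) (g : G) :
    (sumElems X * sumElems Y).coeff g =
      ∑ x ∈ X.toFinite.toFinset, ∑ y ∈ Y.toFinite.toFinset, if x * y = g then 1 else 0 := by
  simp [sumElems, Finset.sum_mul_sum, MonoidAlgebra.single_mul_single, Finsupp.single_apply]

/-- The product of two basic sets is a union of basic sets. -/
theorem Eqv.exists_mul {x y w : G} (h : A.Eqv (x * y) w) :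
    ∃ x' y', A.Eqv x x' ∧ A.Eqv y y' ∧ w = x' * y' := by
  classical
  obtain ⟨X, ⟨hX, hx⟩, -⟩ := A.cover x
  obtain ⟨Y, ⟨hY, hy⟩, -⟩ := A.cover y
  have key := h.coeff_eq (A.mul_mem _ _ (sumElems_mem_span hX) (sumElems_mem_span hY))
  rw [coeff_sumElems_mul, coeff_sumElems_mul] at key
  have hpos : 0 < ∑ a ∈ X.toFinite.toFinset, ∑ b ∈ Y.toFinite.toFinset,
      if a * b = x * y then (1 : ℤ) else 0 := by
    refine Finset.sum_pos' (fun a _ => Finset.sum_nonneg fun b _ => by split_ifs <;> simp)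
      ⟨x, by simpa using hx, ?_⟩
    exact Finset.sum_pos' (fun b _ => by split_ifs <;> simp) ⟨y, by simpa using hy, by simp⟩
  rw [key] at hpos
  obtain ⟨a, ha, hane⟩ := Finset.exists_ne_zero_of_sum_ne_zero hpos.ne'
  obtain ⟨b, hb, hbne⟩ := Finset.exists_ne_zero_of_sum_ne_zero hane
  refine ⟨a, b, ⟨X, hX, hx, by simpa using ha⟩, ⟨Y, hY, hy, by simpa using hb⟩, ?_⟩
  by_contra hne
  exact hbne (if_neg (Ne.symm hne))

/-- Multiplication by an element forming a singleton basic set preserves basic sets. -/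
theorem Eqv.mul_left {u x y : G} (hu : ∀ w, A.Eqv u w → w = u) (h : A.Eqv x y) :
    A.Eqv (u * x) (u * y) := by
  rw [← inv_mul_cancel_left u x] at h
  obtain ⟨v, w, hv, hw, rfl⟩ := h.exists_mul
  have hv' := hu v⁻¹ (by simpa using hv.inv)
  rwa [inv_eq_iff_eq_inv.1 hv', mul_inv_cancel_left]

theorem pow_mem_span {f : MonoidAlgebra ℤ G} (hf : f ∈ A.span) (n : ℕ) : f ^ n ∈ A.span := by
  induction n with
  | zero =>
    have h : sumElems ({1} : Set G) = (1 : MonoidAlgebra ℤ G) := by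
      rw [sumElems, Set.Finite.toFinset_singleton, Finset.sum_singleton, MonoidAlgebra.one_def]
    rw [pow_zero, ← h]
    exact sumElems_mem_span A.one_mem
  | succ n ih => rw [pow_succ]; exact A.mul_mem _ _ ih hf

end Basic

section Comm

variable {G : Type*} [CommGroup G] [Finite G] {A : SRing G}

theorem intCast_coeff_sumElems_pow {q : ℕ} [Fact q.Prime] (X : Set G) (g : G) :
    (((sumElems X ^ q).coeff g : ℤ) : ZMod q) =
      ∑ x ∈ X.toFinite.toFinset, (Finsupp.single (x ^ q) (1 : ZMod q)) g := by
  have : CharP (MonoidAlgebra (ZMod q) G) q :=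
    charP_of_injective_algebraMap (algebraMap (ZMod q) (MonoidAlgebra (ZMod q) G)).injective q
  have hcoe : (((sumElems X ^ q).coeff g : ℤ) : ZMod q) =
      (MonoidAlgebra.mapRingHom G (Int.castRingHom (ZMod q)) (sumElems X ^ q)).coeff g := by
    rw [MonoidAlgebra.coeff_mapRingHom]
    rfl
  rw [hcoe, map_pow, sumElems, map_sum, sum_pow_char (R := MonoidAlgebra (ZMod q) G) q]
  simp [MonoidAlgebra.single_pow]

/-- Schur's theorem on multipliers for a prime multiplier. -/
theorem Eqv.exists_pow_prime {n q : ℕ} (hq : q.Prime) (hqn : q.Coprime n)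
    (hn : ∀ x : G, x ^ n = 1) {x w : G} (h : A.Eqv (x ^ q) w) :
    ∃ y, A.Eqv x y ∧ w = y ^ q := by
  classical
  have : Fact q.Prime := ⟨hq⟩
  obtain ⟨X, ⟨hX, hx⟩, -⟩ := A.cover x
  have key := congrArg (Int.cast : ℤ → ZMod q) (h.coeff_eq (pow_mem_span (sumElems_mem_span hX) q))
  rw [intCast_coeff_sumElems_pow, intCast_coeff_sumElems_pow] at key
  have hinj : ∀ a b : G, a ^ q = b ^ q → a = b := by
    intro a b hab
    have h1 : (a / b) ^ q = 1 := by rw [div_pow, hab, div_self']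
    have h2 := Nat.eq_one_of_dvd_coprimes hqn (orderOf_dvd_of_pow_eq_one h1)
      (orderOf_dvd_of_pow_eq_one (hn _))
    exact div_eq_one.1 (orderOf_eq_one_iff.1 h2)
  have hone : ∑ a ∈ X.toFinite.toFinset, (Finsupp.single (a ^ q) (1 : ZMod q)) (x ^ q) = 1 := by
    rw [Finset.sum_eq_single x]
    · simp
    · intro b _ hb
      exact Finsupp.single_eq_of_ne fun hne => hb (hinj _ _ hne.symm)
    · simp [hx]
  rw [hone] at key
  obtain ⟨y, hy, hyne⟩ := Finset.exists_ne_zero_of_sum_ne_zero (key ▸ one_ne_zero)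
  refine ⟨y, ⟨X, hX, hx, by simpa using hy⟩, ?_⟩
  by_contra hne
  exact hyne (Finsupp.single_eq_of_ne hne)

/-- Schur's theorem on multipliers: raising to a power coprime to the exponent maps
basic sets onto unions of basic sets. -/
theorem Eqv.exists_pow {n m : ℕ} (hm : m.Coprime n) (hm0 : m ≠ 0)
    (hn : ∀ x : G, x ^ n = 1) {x w : G} (h : A.Eqv (x ^ m) w) :
    ∃ y, A.Eqv x y ∧ w = y ^ m := by
  induction m using Nat.recOnMul generalizing x w with
  | zero => exact absurd rfl hm0
  | one => exact ⟨w, by simpa using h, by simp⟩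
  | prime q hq => exact h.exists_pow_prime hq hm hn
  | mul a b ha hb =>
    rw [pow_mul] at h
    obtain ⟨v, hv, rfl⟩ := hb hm.coprime_mul_left (right_ne_zero_of_mul hm0) h
    obtain ⟨y, hy, rfl⟩ := ha hm.coprime_mul_right (left_ne_zero_of_mul hm0) hv
    exact ⟨y, hy, (pow_mul _ _ _).symm⟩

theorem Eqv.pow {n m : ℕ} (hm : m.Coprime n) (hn0 : 1 < n)
    (hn : ∀ x : G, x ^ n = 1) {x y : G} (h : A.Eqv x y) : A.Eqv (x ^ m) (y ^ m) := by
  obtain ⟨k, hk⟩ := Nat.exists_mul_mod_eq_one_of_coprime hm hn0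
  have hpow : ∀ x : G, x ^ (m * k) = x := fun x => by
    rw [← Nat.mod_add_div (m * k) n, hk.2, pow_add, pow_mul, hn]; simp
  have hkn : k.Coprime n := by
    have : (m * k).Coprime n := by
      rw [Nat.Coprime, Nat.gcd_comm, Nat.gcd_rec, hk.2, Nat.gcd_one_left]
    exact this.coprime_mul_left
  have hk0 : k ≠ 0 := by
    rintro rfl
    simp at hk
  rw [← hpow x, pow_mul] at h
  obtain ⟨v, hv, rfl⟩ := h.exists_pow hkn hk0 hn
  rwa [← pow_mul, mul_comm, hpow]

end Comm

/-- An S-ring is cyclotomic if some family of automorphisms preserving all basic sets is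
transitive on each of them. -/
theorem isCyclotomic_of_transitive {G : Type*} [Group G] [Finite G] {A : SRing G}
    (h : ∀ x y, A.Eqv x y → ∃ φ : MulAut G, (∀ w, A.Eqv w (φ w)) ∧ φ x = y) :
    A.IsCyclotomic := by
  let K : Subgroup (MulAut G) :=
    { carrier := {φ | ∀ w, A.Eqv w (φ w)}
      one_mem' := fun w => Eqv.refl A w
      mul_mem' := fun {φ ψ} hφ hψ w => (hψ w).trans (hφ (ψ w))
      inv_mem' := fun {φ} hφ w => by simpa using (hφ (φ⁻¹ w)).symm }
  have hK : ∀ φ, φ ∈ K ↔ ∀ w, A.Eqv w (φ w) := fun _ => Iff.rfl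
  have horb : ∀ X ∈ A.basic, ∀ x ∈ X, (fun φ : MulAut G => φ x) '' (K : Set (MulAut G)) = X := by
    intro X hX x hx
    ext y
    constructor
    · rintro ⟨φ, hφ, rfl⟩
      exact mem_of_eqv ((hK φ).1 hφ x) hX hx
    · intro hy
      obtain ⟨φ, hφ, rfl⟩ := h x y ⟨X, hX, hx, hy⟩
      exact ⟨φ, (hK φ).2 hφ, rfl⟩
  refine ⟨K, ?_⟩
  ext X
  constructor
  · intro hX
    obtain ⟨x, hx⟩ := A.nonempty X hX
    exact ⟨x, horb X hX x hx⟩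
  · rintro ⟨x, rfl⟩
    obtain ⟨X, ⟨hX, hx⟩, -⟩ := A.cover x
    simp only [horb X hX x hx, hX]

/-- If every element is a power of `g`, and every element equivalent to `g` is again a
generator, then an S-ring whose basic sets are the images of the basic set of `g` under
power maps is cyclotomic. -/
theorem isCyclotomic_of_generator {G : Type*} [CommGroup G] [Finite G] {A : SRing G} {g : G}
    (hg : ∀ y, A.Eqv g y → ∀ x, ∃ m : ℕ, x = y ^ m)
    (hpow : ∀ y, A.Eqv g y → ∀ m : ℕ, A.Eqv (g ^ m) (y ^ m))
    (hlift : ∀ (m : ℕ) (t : G), A.Eqv (g ^ m) t → ∃ y, A.Eqv g y ∧ t = y ^ m) :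
    A.IsCyclotomic := by
  refine isCyclotomic_of_transitive fun x t h => ?_
  have hgen := hg g (Eqv.refl A g)
  obtain ⟨m, rfl⟩ := hgen x
  obtain ⟨y, hy, rfl⟩ := hlift m t h
  obtain ⟨k, rfl⟩ := hgen y
  obtain ⟨j, hj⟩ := hg _ hy g
  have hinv : ∀ x : G, (x ^ k) ^ j = x := by
    intro x
    obtain ⟨i, rfl⟩ := hgen x
    rw [← pow_mul, ← pow_mul, mul_comm i, pow_mul, pow_mul g k j, ← hj]
  refine ⟨{ powMonoidHom k with
      invFun := fun x => x ^ j
      left_inv := hinv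
      right_inv := fun x => by simpa [← pow_mul, mul_comm] using hinv x }, fun w => ?_, ?_⟩
  · obtain ⟨i, rfl⟩ := hgen w
    change A.Eqv (g ^ i) ((g ^ i) ^ k)
    rw [← pow_mul, mul_comm, pow_mul]
    exact hpow _ hy i
  · change (g ^ m) ^ k = (g ^ k) ^ m
    rw [← pow_mul, ← pow_mul, mul_comm]

end SRing

/-- If `z ^ 4 = 1`, then the product of `z` and a generator of `D` generates `⟨z⟩ × D`. -/
theorem exists_eq_mul_pow {Q : Type*} [CommGroup Q] {p : ℕ} (hp : p.Prime) (hodd : Odd p)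
    {D : Subgroup Q} (hD : Nat.card D = p) {z d : Q} (hz : z ^ 4 = 1) (hd : d ∈ D) (hd1 : d ≠ 1)
    (hspan : ∀ q : Q, ∃ a : ℕ, ∃ e ∈ D, q = z ^ a * e) (x : Q) : ∃ m : ℕ, x = (z * d) ^ m := by
  have : Fact p.Prime := ⟨hp⟩
  obtain ⟨a, e, he, rfl⟩ := hspan x
  obtain ⟨b, hb⟩ := mem_powers_of_prime_card (g := (⟨d, hd⟩ : D)) (g' := ⟨e, he⟩) hD
    (fun h => hd1 (congrArg Subtype.val h))
  have hb' : d ^ b = e := congrArg Subtype.val hb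
  have hdp : d ^ p = 1 := by
    have := pow_card_eq_one' (x := (⟨d, hd⟩ : D))
    rw [hD] at this
    exact congrArg Subtype.val this
  have hcop : Nat.Coprime 4 p :=
    Nat.Coprime.pow_left 2 (Nat.coprime_two_left.2 hodd)
  obtain ⟨m, hma, hmb⟩ := Nat.chineseRemainder hcop a b
  refine ⟨m, ?_⟩
  rw [mul_pow, ← hb', pow_eq_pow_iff_modEq.2 (hma.of_dvd (orderOf_dvd_of_pow_eq_one hz)),
    pow_eq_pow_iff_modEq.2 (hmb.of_dvd (orderOf_dvd_of_pow_eq_one hdp))]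

/-- An S-ring over the cyclic group `⟨z⟩ × D` of order `4p` is cyclotomic, provided that `D` is
a union of basic sets and the basic set of `z` is contained in `{z, z⁻¹}`. -/
theorem SRing.isCyclotomic_of_card_four_mul {Q : Type*} [CommGroup Q] [Finite Q] {A : SRing Q}
    {p : ℕ} (hp : p.Prime) (hodd : Odd p) {D : Subgroup Q} (hD : Nat.card D = p) {z : Q}
    (hz : z ^ 4 = 1) (hspan : ∀ q : Q, ∃ a : ℕ, ∃ e ∈ D, q = z ^ a * e)
    (hDA : ∀ x y, A.Eqv x y → x ∈ D → y ∈ D)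
    (hzA : ∀ y, A.Eqv z y → y = z ∨ y = z⁻¹) : A.IsCyclotomic := by
  have hDp : ∀ d ∈ D, d ^ p = 1 := fun d hd => by
    have := pow_card_eq_one' (x := (⟨d, hd⟩ : D))
    rw [hD] at this
    exact congrArg Subtype.val this
  have hzinv : z⁻¹ ^ 4 = 1 := by rw [inv_pow, hz, inv_one]
  have hzz : z⁻¹ ^ 2 = z ^ 2 := by
    rw [inv_pow, inv_eq_iff_mul_eq_one, ← pow_add, hz]
  have hexp : ∀ x : Q, x ^ (4 * p) = 1 := fun x => by
    obtain ⟨a, e, he, rfl⟩ := hspan x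
    have h1 : (z ^ a) ^ (4 * p) = 1 := by rw [← pow_mul, mul_left_comm, pow_mul, hz, one_pow]
    have h2 : e ^ (4 * p) = 1 := by rw [mul_comm, pow_mul, hDp e he, one_pow]
    rw [mul_pow, h1, h2, mul_one]
  have hn1 : 1 < 4 * p := by have := hp.pos; omega
  have hspan' : ∀ q : Q, ∃ a : ℕ, ∃ e ∈ D, q = z⁻¹ ^ a * e := fun q => by
    obtain ⟨a, e, he, rfl⟩ := hspan q
    refine ⟨3 * a, e, he, ?_⟩
    rw [pow_mul, show z⁻¹ ^ 3 = z by
      rw [inv_pow, inv_eq_iff_mul_eq_one, ← pow_succ, hz]]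
  have hzeven : ∀ w, w = z ∨ w = z⁻¹ → ∀ m, Even m → w ^ m = z ^ m := by
    rintro w (rfl | rfl) m hm
    · rfl
    · obtain ⟨j, rfl⟩ := hm.two_dvd
      rw [pow_mul, hzz, pow_mul]
  have hz2 : ∀ w, A.Eqv (z ^ 2) w → w = z ^ 2 := by
    intro w hw
    rw [pow_two] at hw
    obtain ⟨u, v, hu, hv, rfl⟩ := hw.exists_mul
    rcases hzA u hu with rfl | rfl <;> rcases hzA v hv with rfl | rfl
    · rw [pow_two]
    · rw [mul_inv_cancel] at hw ⊢
      rw [pow_two, hw.symm.eq_one]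
    · rw [inv_mul_cancel] at hw ⊢
      rw [pow_two, hw.symm.eq_one]
    · rw [← pow_two, hzz]
  have hz2m : ∀ m, Even m → ∀ w, A.Eqv (z ^ m) w → w = z ^ m := by
    intro m hm w hw
    obtain ⟨j, rfl⟩ := hm.two_dvd
    rcases Nat.even_or_odd' j with ⟨i, rfl | rfl⟩
    · have h1 : z ^ (2 * (2 * i)) = 1 := by rw [← mul_assoc, pow_mul]; simp [hz]
      rw [h1] at hw ⊢
      exact hw.eq_one
    · have h1 : z ^ (2 * (2 * i + 1)) = z ^ 2 := by
        rw [mul_add, ← mul_assoc, pow_add, pow_mul]; simp [hz]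
      rw [h1] at hw ⊢
      exact hz2 w hw
  have hcop4 : ∀ m : ℕ, Odd m → m.Coprime 4 := fun m hm =>
    Nat.Coprime.pow_right 2 (Nat.coprime_two_right.2 hm)
  have hcop : ∀ m : ℕ, Odd m → ¬ p ∣ m → m.Coprime (4 * p) := fun m hm hpm =>
    (hcop4 m hm).mul_right ((hp.coprime_iff_not_dvd.2 hpm).symm)
  have hzodd : ∀ m : ℕ, Odd m → ∃ k, k.Coprime (4 * p) ∧ k ≠ 0 ∧
      ∀ w : Q, w ^ 4 = 1 → w ^ m = w ^ k := by
    intro m hm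
    obtain ⟨k, hk⟩ := Nat.chineseRemainder
      (show Nat.Coprime 4 p from Nat.Coprime.pow_left 2 (Nat.coprime_two_left.2 hodd)) m 1
    have hkp : ¬ p ∣ k := fun h => hp.one_lt.ne' (Nat.dvd_one.1 ((hk.2.dvd_iff dvd_rfl).1 h))
    have hkodd : Odd k := by
      have := hk.1
      rw [Nat.ModEq] at this
      rw [Nat.odd_iff] at hm ⊢
      omega
    refine ⟨k, hcop k hkodd hkp, fun h => hkp (h ▸ dvd_zero p), fun w hw => ?_⟩
    exact pow_eq_pow_iff_modEq.2 (hk.1.symm.of_dvd (orderOf_dvd_of_pow_eq_one hw))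
  have hdeven : ∀ m : ℕ, Even m → ¬ p ∣ m → ∃ k, k.Coprime (4 * p) ∧ k ≠ 0 ∧
      ∀ e ∈ D, e ^ m = e ^ k := by
    intro m hm hpm
    refine ⟨m + p, hcop _ (hm.add_odd hodd) (by simpa using hpm), ?_, fun e he => ?_⟩
    · have := hp.pos; omega
    · rw [pow_add, hDp e he, mul_one]
  obtain ⟨d, hd, hd1⟩ : ∃ d ∈ D, d ≠ 1 := by
    refine D.bot_or_exists_ne_one.resolve_left ?_
    rintro rfl
    exact hp.one_lt.ne (by simpa using hD)
  have hsplit : ∀ y, A.Eqv (z * d) y → ∃ w e, A.Eqv z w ∧ A.Eqv d e ∧ y = w * e :=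
    fun y hy => hy.exists_mul
  refine SRing.isCyclotomic_of_generator (g := z * d) ?_ ?_ ?_
  · intro y hy x
    obtain ⟨w, e, hw, he, rfl⟩ := hsplit y hy
    have heD := hDA _ _ he hd
    have he1 : e ≠ 1 := by
      rintro rfl
      exact hd1 he.symm.eq_one
    rcases hzA w hw with rfl | rfl
    · exact exists_eq_mul_pow hp hodd hD hz heD he1 hspan x
    · exact exists_eq_mul_pow hp hodd hD hzinv heD he1 hspan' x
  · intro y hy m
    obtain ⟨w, e, hw, he, rfl⟩ := hsplit y hy
    have heD := hDA _ _ he hd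
    have hw4 : w ^ 4 = 1 := by
      rcases hzA w hw with rfl | rfl
      exacts [hz, hzinv]
    by_cases hpm : p ∣ m
    · rw [mul_pow, mul_pow, orderOf_dvd_iff_pow_eq_one.1
        ((orderOf_dvd_of_pow_eq_one (hDp d hd)).trans hpm), orderOf_dvd_iff_pow_eq_one.1
        ((orderOf_dvd_of_pow_eq_one (hDp e heD)).trans hpm), mul_one, mul_one]
      rcases Nat.even_or_odd m with hm | hm
      · rw [hzeven w (hzA w hw) m hm]
        exact Eqv.refl A _
      · obtain ⟨k, hk, -, hkz⟩ := hzodd m hm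
        rw [hkz z hz, hkz w hw4]
        exact hw.pow hk hn1 hexp
    · rcases Nat.even_or_odd m with hm | hm
      · obtain ⟨k, hk, -, hkD⟩ := hdeven m hm hpm
        rw [mul_pow, mul_pow, hzeven w (hzA w hw) m hm, hkD d hd, hkD e heD]
        exact Eqv.mul_left (hz2m m hm) (he.pow hk hn1 hexp)
      · exact hy.pow (hcop m hm hpm) hn1 hexp
  · intro m t ht
    by_cases hpm : p ∣ m
    · have hDm : ∀ e ∈ D, e ^ m = 1 := fun e he => orderOf_dvd_iff_pow_eq_one.1
        ((orderOf_dvd_of_pow_eq_one (hDp e he)).trans hpm)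
      rw [mul_pow, hDm d hd, mul_one] at ht
      rcases Nat.even_or_odd m with hm | hm
      · refine ⟨z * d, Eqv.refl A _, ?_⟩
        rw [mul_pow, hDm d hd, mul_one]
        exact hz2m m hm t ht
      · obtain ⟨k, hk, hk0, hkz⟩ := hzodd m hm
        rw [hkz z hz] at ht
        obtain ⟨w, hw, rfl⟩ := ht.exists_pow hk hk0 hexp
        have hw4 : w ^ 4 = 1 := by
          rcases hzA w hw with rfl | rfl
          exacts [hz, hzinv]
        rw [← mul_inv_cancel_right z d] at hw
        obtain ⟨y, e, hy, he, rfl⟩ := hw.exists_mul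
        refine ⟨y, hy, ?_⟩
        rw [← hkz _ hw4, mul_pow, hDm e (hDA _ _ he (D.inv_mem hd)), mul_one]
    · rcases Nat.even_or_odd m with hm | hm
      · obtain ⟨k, hk, hk0, hkD⟩ := hdeven m hm hpm
        rw [mul_pow] at ht
        obtain ⟨u, v, hu, hv, rfl⟩ := ht.exists_mul
        rw [hz2m m hm u hu]
        rw [hkD d hd] at hv
        obtain ⟨e, he, rfl⟩ := hv.exists_pow hk hk0 hexp
        rw [← hkD e (hDA _ _ he hd)]
        rw [← inv_mul_cancel_left z d] at he
        obtain ⟨w, y, hw, hy, rfl⟩ := he.exists_mul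
        refine ⟨y, hy, ?_⟩
        have hw' := hzA w⁻¹ (by simpa using hw.inv)
        have hwm : z ^ m * w ^ m = 1 := by
          rw [← hzeven _ hw' m hm, ← mul_pow, inv_mul_cancel, one_pow]
        rw [mul_pow, ← mul_assoc, hwm, one_mul]
      · exact ht.exists_pow (hcop m hm hpm) (by rintro rfl; simp at hpm) hexp

/-- Suppose `C = ⟨c⟩` is not an `𝒜`-subgroup, `H` is an
`𝒜`-subgroup, and the basic set `X ∋ c` has the form `X = Lc` for an `𝒜`-subgroup
`L` with `|L| ∈ {p, 2p}`; put `L₁ = L ∩ H`. Then `𝒜_{G/L₁}` is cyclotomic. -/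
theorem stmt19 (p : ℕ) (hp : p.Prime) (hodd : Odd p)
    (G : Type*) [CommGroup G] [Finite G] (C H : Subgroup G)
    (hC : Nonempty (↥C ≃* Multiplicative (ZMod 4)))
    (hH : Nonempty (↥H ≃* Multiplicative (ZMod p) × Multiplicative (ZMod p)))
    (hinf : C ⊓ H = ⊥) (hsup : C ⊔ H = ⊤)
    (K : Subgroup (Equiv.Perm G)) (hK : InSup2Min K)
    (A : SRing G) (hA : A.basic = VBasic K)
    (c : G) (hc : Subgroup.zpowers c = C) (hc4 : orderOf c = 4)
    (hCA : ¬ A.IsASubgroup C) (hHA : A.IsASubgroup H)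
    (X : Set G) (hX : X ∈ A.basic) (hcX : c ∈ X)
    (L : Subgroup G) (hLA : A.IsASubgroup L)
    (hLcard : Nat.card ↥L ∈ ({p, 2 * p} : Set ℕ))
    (hXL : X = c • (L : Set G)) :
    ∀ AQ : SRing (G ⧸ (L ⊓ H)), AQ.basic = quotBasic A (L ⊓ H) →
      AQ.IsCyclotomic := by
  intro AQ hAQ
  have : Fact p.Prime := ⟨hp⟩
  have hZcard : Nat.card (Multiplicative (ZMod p)) = p := Nat.card_zmod p
  have hZpow : ∀ x : Multiplicative (ZMod p), x ^ p = 1 := fun x =>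
    orderOf_dvd_iff_pow_eq_one.1 ((orderOf_dvd_natCard x).trans hZcard.dvd)
  have hHp : ∀ h ∈ H, h ^ p = 1 := by
    intro h hh
    obtain ⟨e⟩ := hH
    have h1 : (⟨h, hh⟩ : H) ^ p = 1 := e.injective (by
      rw [map_pow, map_one]
      exact Prod.ext (hZpow _) (hZpow _))
    exact congrArg Subtype.val h1
  have hHcard : Nat.card H = p ^ 2 := by
    obtain ⟨e⟩ := hH
    rw [Nat.card_congr e.toEquiv, Nat.card_prod, hZcard, pow_two]
  have hspan : ∀ g : G, ∃ a : ℕ, ∃ h ∈ H, g = c ^ a * h := by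
    intro g
    obtain ⟨y, hy, h, hh, rfl⟩ := Subgroup.mem_sup.1 (hsup ▸ Subgroup.mem_top g : g ∈ C ⊔ H)
    rw [← hc] at hy
    obtain ⟨a, rfl⟩ := (mem_powers_iff_mem_zpowers.2 hy : y ∈ Submonoid.powers c)
    exact ⟨a, h, hh, rfl⟩
  have hc1 : c ^ 4 = 1 := hc4 ▸ pow_orderOf_eq_one c
  have hcop : Nat.Coprime 4 p := Nat.Coprime.pow_left 2 (Nat.coprime_two_left.2 hodd)
  have hLpow : ∀ l ∈ L, l ^ (2 * p) = 1 := by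
    intro l hl
    have h1 : l ^ Nat.card L = 1 := congrArg Subtype.val (pow_card_eq_one' (x := (⟨l, hl⟩ : L)))
    rcases hLcard with h | h
    · rw [h] at h1
      rw [mul_comm, pow_mul, h1, one_pow]
    · rwa [h] at h1
  have hLdec : ∀ l ∈ L, ∃ a, Even a ∧ ∃ h ∈ L ⊓ H, l = c ^ a * h := by
    intro l hl
    obtain ⟨a, h, hh, rfl⟩ := hspan l
    refine ⟨a, ?_, h, ⟨?_, hh⟩, rfl⟩
    · have h1 := hLpow _ hl
      rw [mul_pow, mul_comm 2 p, pow_mul h, hHp h hh, one_pow, mul_one, ← pow_mul] at h1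
      have h2 := orderOf_dvd_of_pow_eq_one h1
      rw [hc4, mul_comm p 2, mul_left_comm] at h2
      have h3 : 2 ∣ a * p := Nat.dvd_of_mul_dvd_mul_left two_pos h2
      exact even_iff_two_dvd.2 ((Nat.coprime_two_left.2 hodd).dvd_of_dvd_mul_right h3)
    · obtain ⟨m, hm4, hmp⟩ := Nat.chineseRemainder hcop 0 1
      have h1 := L.pow_mem hl m
      rwa [mul_pow, ← pow_mul, mul_comm a m, pow_mul,
        pow_eq_pow_iff_modEq.2 (hm4.of_dvd hc4.dvd), pow_zero, one_pow, one_mul,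
        pow_eq_pow_iff_modEq.2 (hmp.of_dvd (orderOf_dvd_of_pow_eq_one (hHp h hh))),
        pow_one] at h1
  have hL1 : Nat.card ↥(L ⊓ H) = p := by
    have hdvdL : Nat.card ↥(L ⊓ H) ∣ 2 * p := by
      refine (Subgroup.card_dvd_of_le inf_le_left).trans ?_
      rcases hLcard with h | h <;> rw [h]
      exact dvd_mul_left p 2
    have hdvdH : Nat.card ↥(L ⊓ H) ∣ p ^ 2 :=
      hHcard ▸ Subgroup.card_dvd_of_le inf_le_right
    have hdvd : Nat.card ↥(L ⊓ H) ∣ p :=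
      ((Nat.coprime_two_left.2 hodd).symm.pow_left 2 |>.coprime_dvd_left hdvdH).dvd_of_dvd_mul_left
        hdvdL
    refine ((Nat.dvd_prime hp).1 hdvd).resolve_left fun h1 => ?_
    obtain ⟨l, hl⟩ := exists_prime_orderOf_dvd_card' (G := L) p (by
      rcases hLcard with h | h <;> rw [h]
      exact dvd_mul_left p 2)
    obtain ⟨a, ha, h, hh, hal⟩ := hLdec l l.2
    rw [Subgroup.card_eq_one.1 h1, Subgroup.mem_bot] at hh
    have hl2 : l ^ 2 = 1 := by
      ext
      obtain ⟨j, rfl⟩ := ha.two_dvd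
      rw [Subgroup.coe_pow, hal, hh, mul_one, ← pow_mul, mul_right_comm, pow_mul,
        show 2 * 2 = 4 from rfl, hc1, one_pow, Subgroup.coe_one]
    have h2 := orderOf_dvd_of_pow_eq_one hl2
    rw [hl, (Nat.prime_dvd_prime_iff_eq hp Nat.prime_two)] at h2
    subst h2
    exact absurd hodd (by decide)
  let π := QuotientGroup.mk' (L ⊓ H)
  have hEqv : ∀ g u, AQ.Eqv (π g) u → ∃ g', A.Eqv g g' ∧ u = π g' := by
    intro g u h
    obtain ⟨Y, ⟨hY, hgY⟩, -⟩ := A.cover g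
    have hYQ : QuotientGroup.mk '' Y ∈ AQ.basic := hAQ ▸ ⟨Y, hY, rfl⟩
    obtain ⟨g', hg', rfl⟩ := SRing.mem_of_eqv h hYQ ⟨g, hgY, rfl⟩
    exact ⟨g', ⟨Y, hY, hgY, hg'⟩, rfl⟩
  refine SRing.isCyclotomic_of_card_four_mul hp hodd (D := H.map π) (z := π c) ?_ ?_ ?_ ?_ ?_
  · have h1 : Nat.card (H.map π) = (L ⊓ H).relIndex H := by
      rw [← Subgroup.relIndex_ker, QuotientGroup.ker_mk']
    have h2 := Subgroup.relIndex_mul_relIndex ⊥ (L ⊓ H) H bot_le inf_le_right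
    rw [Subgroup.relIndex_bot_left, Subgroup.relIndex_bot_left, hL1, hHcard, pow_two, ← h1] at h2
    exact Nat.eq_of_mul_eq_mul_left hp.pos h2
  · rw [← map_pow, hc1, map_one]
  · intro q
    obtain ⟨g, rfl⟩ := QuotientGroup.mk'_surjective _ q
    obtain ⟨a, h, hh, rfl⟩ := hspan g
    exact ⟨a, π h, ⟨h, hh, rfl⟩, by rw [← map_pow, ← map_mul]⟩
  · rintro _ y hxy ⟨x, hx, rfl⟩
    obtain ⟨g, hg, rfl⟩ := hEqv x y hxy
    exact ⟨g, hHA.mem_of_eqv hg hx, rfl⟩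
  · intro y hy
    obtain ⟨g, hg, rfl⟩ := hEqv c y hy
    have hgX := SRing.mem_of_eqv hg hX hcX
    rw [hXL] at hgX
    obtain ⟨l, hl, rfl⟩ := hgX
    obtain ⟨a, ha, h, hh, rfl⟩ := hLdec l hl
    have hπh : π h = 1 := (QuotientGroup.eq_one_iff h).2 hh
    obtain ⟨j, rfl⟩ := ha.two_dvd
    have hval : π (c • (c ^ (2 * j) * h)) = π (c * (c ^ 2) ^ j) := by
      rw [smul_eq_mul, ← mul_assoc, map_mul, hπh, mul_one, pow_mul]
    have hc22 : (c ^ 2) ^ 2 = 1 := by rw [← pow_mul, hc1]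
    change π (c • (c ^ (2 * j) * h)) = _ ∨ π (c • (c ^ (2 * j) * h)) = _
    rw [hval]
    rcases Nat.even_or_odd' j with ⟨i, rfl | rfl⟩
    · left
      rw [pow_mul, hc22, one_pow, mul_one]
    · right
      rw [pow_succ, pow_mul, hc22, one_pow, one_mul, ← map_inv]
      congr 1
      rw [eq_inv_iff_mul_eq_one, ← pow_succ', ← pow_succ, hc1]

end Paper
end
end
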